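/- arXiv:math/0305440 — 10 statements merged into one kernel-verified Lean document; each statement's English description precedes it below -/
import Mathlib

section
/- Let G be a sofic group and D a division ring. Then there exist a ring R and an injective ring homomorphism from the group algebra D(G) into R such that R is von Neumann regular (for every x in R there exists y in R with x·y·x = x) and simple (the only two-sided ideals of R are the zero ideal and R itself). -/
/-- A group `G` is *sofic* if for every `ε ∈ (0,1)` and every finite subset `F ⊆ G`
there are a nonempty finite set `V` and a map `φ : G → Map(V)` such that:
(a) for `e, f ∈ F`, `φ(ef)` differs from `φ(e) ∘ φ(f)` at no more than `ε|V|` points;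
(b) `φ(1)` differs from the identity at no more than `ε|V|` points;
(c) for `e ∈ F`, `e ≠ 1`, the map `φ(e)` agrees with the identity at fewer than `ε|V|` points. -/
def IsSofic (G : Type*) [Group G] : Prop :=
  ∀ ε : ℝ, 0 < ε → ε < 1 → ∀ F : Finset G,
    ∃ (V : Type) (_ : Fintype V) (_ : Nonempty V) (φ : G → V → V),
      (∀ e ∈ F, ∀ f ∈ F,
        (Nat.card {v : V | φ (e * f) v ≠ φ e (φ f v)} : ℝ) ≤ ε * Nat.card V) ∧
      ((Nat.card {v : V | φ 1 v ≠ v} : ℝ) ≤ ε * Nat.card V) ∧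
      (∀ e ∈ F, e ≠ 1 → (Nat.card {v : V | φ e v = v} : ℝ) < ε * Nat.card V)

universe u v

namespace Module.End

variable {K : Type*} {M : Type*} [DivisionRing K] [AddCommGroup M] [Module K M]

theorem exists_mul_mul_self (x : Module.End K M) : ∃ y : Module.End K M, x * y * x = x := by
  obtain ⟨s, hs⟩ := x.rangeRestrict.exists_rightInverse_of_surjective x.range_rangeRestrict
  obtain ⟨y, hy⟩ := LinearMap.exists_extend s
  refine ⟨y, LinearMap.ext fun m => ?_⟩
  have h₁ : y (x m) = s (x.rangeRestrict m) := DFunLike.congr_fun hy (x.rangeRestrict m)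
  have h₂ := congr_arg Subtype.val (DFunLike.congr_fun hs (x.rangeRestrict m))
  simpa [h₁] using h₂

theorem finrank_range_zero : finrank K (0 : Module.End K M).range = 0 := by
  rw [LinearMap.range_zero, finrank_bot]

variable [FiniteDimensional K M]

theorem finrank_range_add_le (x y : Module.End K M) :
    finrank K (x + y).range ≤ finrank K x.range + finrank K y.range :=
  (Submodule.finrank_mono (LinearMap.range_add_le x y)).trans
    (Submodule.finrank_add_le_finrank_add_finrank _ _)

theorem finrank_range_mul_le_left (x y : Module.End K M) :
    finrank K (x * y).range ≤ finrank K x.range :=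
  Submodule.finrank_mono (LinearMap.range_comp_le_range y x)

theorem finrank_range_mul_le_right (x y : Module.End K M) :
    finrank K (x * y).range ≤ finrank K y.range := by
  rw [Module.End.mul_eq_comp, LinearMap.range_comp]
  exact Submodule.finrank_map_le x y.range

/-- An endomorphism of rank at most that of `x` factors through `x`. -/
theorem exists_eq_mul_mul_of_finrank_range_le {x y : Module.End K M}
    (h : finrank K y.range ≤ finrank K x.range) : ∃ a b : Module.End K M, y = a * x * b := by
  obtain ⟨j, hj⟩ := finrank_le_iff_exists_linearMap.mp h
  obtain ⟨s, hs⟩ := x.rangeRestrict.exists_rightInverse_of_surjective x.range_rangeRestrict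
  obtain ⟨l, hl⟩ := j.exists_leftInverse_of_injective (LinearMap.ker_eq_bot.mpr hj)
  obtain ⟨a, ha⟩ := LinearMap.exists_extend (y.range.subtype ∘ₗ l)
  refine ⟨a, s ∘ₗ j ∘ₗ y.rangeRestrict, LinearMap.ext fun m => ?_⟩
  have h₁ : x (s (j (y.rangeRestrict m))) = j (y.rangeRestrict m) :=
    congr_arg Subtype.val (DFunLike.congr_fun hs (j (y.rangeRestrict m)))
  have h₂ : a (j (y.rangeRestrict m)) = l (j (y.rangeRestrict m)) :=
    DFunLike.congr_fun ha (j (y.rangeRestrict m))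
  have h₃ : l (j (y.rangeRestrict m)) = y.rangeRestrict m := DFunLike.congr_fun hl _
  simp [h₁, h₂, h₃]

theorem exists_add_of_finrank_range_le {y : Module.End K M} {r s : ℕ}
    (h : finrank K y.range ≤ r + s) : ∃ y₁ y₂ : Module.End K M,
      y = y₁ + y₂ ∧ finrank K y₁.range ≤ r ∧ finrank K y₂.range ≤ s := by
  rcases le_total (finrank K y.range) r with hr | hr
  · exact ⟨y, 0, (add_zero y).symm, hr, by simp [finrank_range_zero]⟩
  obtain ⟨f, hf⟩ := exists_linearIndependent_of_le_finrank hr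
  have hp := finrank_span_eq_card hf
  rw [Fintype.card_fin] at hp
  generalize Submodule.span K (Set.range f) = p at hp
  obtain ⟨π, hπ⟩ := p.subtype.exists_leftInverse_of_injective p.ker_subtype
  have hπ' : ∀ z : p, π z = z := DFunLike.congr_fun hπ
  have hπ_range : π.range = ⊤ := LinearMap.range_eq_top.mpr fun z => ⟨z, hπ' z⟩
  have hker := π.finrank_range_add_finrank_ker
  rw [hπ_range, finrank_top, hp] at hker
  let y₁ : Module.End K M := y.range.subtype ∘ₗ p.subtype ∘ₗ π ∘ₗ y.rangeRestrict
  refine ⟨y₁, y - y₁, by simp, ?_, ?_⟩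
  · have h₁ : y₁.range ≤ p.map y.range.subtype := by
      rintro _ ⟨m, rfl⟩
      exact ⟨_, (π (y.rangeRestrict m)).2, rfl⟩
    exact (Submodule.finrank_mono h₁).trans ((Submodule.finrank_map_le _ _).trans hp.le)
  · have h₂ : (y - y₁).range ≤ π.ker.map y.range.subtype := by
      rintro _ ⟨m, rfl⟩
      exact ⟨y.rangeRestrict m - π (y.rangeRestrict m),
        LinearMap.mem_ker.mpr (by rw [map_sub, hπ', sub_self]), rfl⟩
    exact (Submodule.finrank_mono h₂).trans ((Submodule.finrank_map_le _ _).trans (by omega))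

end Module.End

namespace Filter

open Module

variable {ι K : Type*} {M : ι → Type*} [DivisionRing K] [∀ i, AddCommGroup (M i)]
  [∀ i, Module K (M i)] [∀ i, FiniteDimensional K (M i)]

variable (M) in
/-- The families of endomorphisms whose normalized rank tends to zero along a filter. -/
def rankIdeal (K : Type*) [DivisionRing K] [∀ i, Module K (M i)] [∀ i, FiniteDimensional K (M i)]
    (l : Filter ι) : TwoSidedIdeal (∀ i, Module.End K (M i)) :=
  TwoSidedIdeal.mk'
    {x | ∀ ε : ℝ, 0 < ε → ∀ᶠ i in l, (finrank K (x i).range : ℝ) ≤ ε * finrank K (M i)}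
    (fun ε hε => Eventually.of_forall fun i => by
      rw [Pi.zero_apply, End.finrank_range_zero, Nat.cast_zero]
      positivity)
    (fun {x y} hx hy ε hε => by
      filter_upwards [hx (ε / 2) (half_pos hε), hy (ε / 2) (half_pos hε)] with i h₁ h₂
      have h₃ : (finrank K (x i + y i).range : ℝ) ≤ finrank K (x i).range + finrank K (y i).range :=
        mod_cast End.finrank_range_add_le (x i) (y i)
      simp only [Pi.add_apply]
      linarith)
    (fun {x} hx ε hε => by
      filter_upwards [hx ε hε] with i h
      change (finrank K (-x i).range : ℝ) ≤ _
      rwa [LinearMap.range_neg])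
    (fun {x y} hy ε hε => by
      filter_upwards [hy ε hε] with i h
      exact le_trans (mod_cast End.finrank_range_mul_le_right (x i) (y i)) h)
    (fun {x y} hx ε hε => by
      filter_upwards [hx ε hε] with i h
      exact le_trans (mod_cast End.finrank_range_mul_le_left (x i) (y i)) h)

theorem mem_rankIdeal {l : Filter ι} {x : ∀ i, Module.End K (M i)} :
    x ∈ rankIdeal M K l ↔
      ∀ ε : ℝ, 0 < ε → ∀ᶠ i in l, (finrank K (x i).range : ℝ) ≤ ε * finrank K (M i) :=
  TwoSidedIdeal.mem_mk' ..

theorem ringCon_mk'_rankIdeal_eq_zero_iff {l : Filter ι} {x : ∀ i, Module.End K (M i)} :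
    (rankIdeal M K l).ringCon.mk' x = 0 ↔ x ∈ rankIdeal M K l := by
  rw [← TwoSidedIdeal.mem_ker, TwoSidedIdeal.ker_ringCon_mk']

theorem exists_mul_mul_self_quotient_rankIdeal (l : Filter ι)
    (x : (rankIdeal M K l).ringCon.Quotient) :
    ∃ y : (rankIdeal M K l).ringCon.Quotient, x * y * x = x := by
  obtain ⟨x, rfl⟩ := (rankIdeal M K l).ringCon.mk'_surjective x
  choose y hy using fun i => (x i).exists_mul_mul_self
  refine ⟨(rankIdeal M K l).ringCon.mk' y, ?_⟩
  rw [← map_mul, ← map_mul]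
  exact congr_arg _ (funext hy)

/-- A two-sided ideal containing `rankIdeal` and `x` contains every family whose rank is
eventually bounded by a multiple of the rank of `x`. -/
theorem mem_of_finrank_range_le_mul {l : Filter ι} {J : TwoSidedIdeal (∀ i, Module.End K (M i))}
    (hJ : rankIdeal M K l ≤ J) {x : ∀ i, Module.End K (M i)} (hx : x ∈ J) (N : ℕ)
    {y : ∀ i, Module.End K (M i)}
    (hy : ∀ᶠ i in l, finrank K (y i).range ≤ N * finrank K (x i).range) : y ∈ J := by
  induction N generalizing y with
  | zero =>
    refine hJ (mem_rankIdeal.mpr fun ε hε => hy.mono fun i hi => ?_)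
    rw [zero_mul, Nat.le_zero] at hi
    rw [hi, Nat.cast_zero]
    positivity
  | succ N ih =>
    have h : ∀ i, ∃ a b z : Module.End K (M i),
        finrank K (y i).range ≤ (N + 1) * finrank K (x i).range →
          y i = a * x i * b + z ∧ finrank K z.range ≤ N * finrank K (x i).range := by
      intro i
      by_cases hi : finrank K (y i).range ≤ (N + 1) * finrank K (x i).range
      · rw [add_one_mul, add_comm] at hi
        obtain ⟨y₁, z, hadd, h₁, h₂⟩ := End.exists_add_of_finrank_range_le hi
        obtain ⟨a, b, rfl⟩ := End.exists_eq_mul_mul_of_finrank_range_le h₁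
        exact ⟨a, b, z, fun _ => ⟨hadd, h₂⟩⟩
      · exact ⟨0, 0, 0, fun h => absurd h hi⟩
    choose a b z h using h
    have hz : z ∈ J := ih (hy.mono fun i hi => (h i hi).2)
    have hrest : y - (a * x * b + z) ∈ J := by
      refine hJ (mem_rankIdeal.mpr fun ε hε => hy.mono fun i hi => ?_)
      have h₀ : (y - (a * x * b + z)) i = 0 := sub_eq_zero.mpr (h i hi).1
      rw [h₀, End.finrank_range_zero, Nat.cast_zero]
      positivity
    rw [← sub_add_cancel y (a * x * b + z)]
    exact J.add_mem hrest (J.add_mem (J.mul_mem_right _ _ (J.mul_mem_left _ _ hx)) hz)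

theorem eq_bot_or_eq_top_quotient_rankIdeal (ω : Ultrafilter ι)
    (I : TwoSidedIdeal (rankIdeal M K (ω : Filter ι)).ringCon.Quotient) : I = ⊥ ∨ I = ⊤ := by
  set q := (rankIdeal M K (ω : Filter ι)).ringCon.mk'
  by_cases hI : ∃ x, q x ∈ I ∧ x ∉ rankIdeal M K (ω : Filter ι)
  · right
    obtain ⟨x, hxI, hx⟩ := hI
    simp only [mem_rankIdeal, not_forall, exists_prop] at hx
    obtain ⟨ε, hε, hx⟩ := hx
    obtain ⟨N, hN⟩ := exists_nat_ge ε⁻¹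
    have hle : rankIdeal M K (ω : Filter ι) ≤ TwoSidedIdeal.comap q I := fun y hy => by
      rw [TwoSidedIdeal.mem_comap, ringCon_mk'_rankIdeal_eq_zero_iff.mpr hy]
      exact I.zero_mem
    have h1 : (1 : ∀ i, Module.End K (M i)) ∈ TwoSidedIdeal.comap q I := by
      refine mem_of_finrank_range_le_mul hle ((TwoSidedIdeal.mem_comap q).mpr hxI) N ?_
      filter_upwards [Ultrafilter.eventually_not.mpr hx] with i hi
      have h₁ : (finrank K (M i) : ℝ) ≤ N * finrank K (x i).range := by
        rw [not_le] at hi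
        calc (finrank K (M i) : ℝ) = ε⁻¹ * (ε * finrank K (M i)) := by field_simp
          _ ≤ N * finrank K (x i).range := by gcongr
      exact (LinearMap.finrank_range_le _).trans (mod_cast h₁)
    rw [TwoSidedIdeal.mem_comap, map_one] at h1
    exact I.one_mem_iff.mp h1
  · left
    refine le_bot_iff.mp fun y hy => ?_
    obtain ⟨x, rfl⟩ := (rankIdeal M K (ω : Filter ι)).ringCon.mk'_surjective y
    rw [TwoSidedIdeal.mem_bot, ringCon_mk'_rankIdeal_eq_zero_iff]
    by_contra hx
    exact hI ⟨x, hy, hx⟩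

end Filter

section RightModule

open Module

variable {D : Type*} [DivisionRing D]

/-- A division ring is free of rank one as a right module over itself. -/
def MulOpposite.linearEquivSelf (D : Type*) [DivisionRing D] : Dᵐᵒᵖ ≃ₗ[Dᵐᵒᵖ] D where
  __ := MulOpposite.opEquiv.symm
  map_add' _ _ := rfl
  map_smul' _ _ := rfl

instance MulOpposite.finite_self : Module.Finite Dᵐᵒᵖ D :=
  Module.Finite.equiv (MulOpposite.linearEquivSelf D)

variable {V : Type*}

theorem finrank_mulOpposite_fun [Fintype V] : finrank Dᵐᵒᵖ (V → D) = Nat.card V := by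
  rw [finrank_pi_fintype, ← (MulOpposite.linearEquivSelf D).finrank_eq, finrank_self]
  simp

variable [Finite V]

theorem Module.End.finrank_range_le_card_of_support {z : Module.End Dᵐᵒᵖ (V → D)} {S : Set V}
    (h : ∀ f, ∀ v ∉ S, z f v = 0) : finrank Dᵐᵒᵖ z.range ≤ Nat.card S := by
  have := Fintype.ofFinite S
  rw [← finrank_mulOpposite_fun (D := D)]
  refine LinearMap.finrank_le_finrank_of_injective
    (f := LinearMap.funLeft Dᵐᵒᵖ D ((↑) : S → V) ∘ₗ z.range.subtype) ?_
  rw [← LinearMap.ker_eq_bot, LinearMap.ker_eq_bot']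
  rintro ⟨_, f, rfl⟩ hf
  ext v
  by_cases hv : v ∈ S
  · exact congr_fun hf ⟨v, hv⟩
  · exact h f v hv

/-- Some set of at most `rank z` coordinates detects whether `z f` vanishes. It is found as a
maximal set of coordinates onto which the range of `z` projects surjectively. -/
theorem Module.End.exists_card_le_finrank_range (z : Module.End Dᵐᵒᵖ (V → D)) :
    ∃ W : Finset V, W.card ≤ finrank Dᵐᵒᵖ z.range ∧
      ∀ f, (∀ w ∈ W, z f w = 0) → z f = 0 := by
  classical
  have := Fintype.ofFinite V
  let P : Finset V → Prop := fun W => ∀ h : V → D, ∃ f, ∀ w ∈ W, z f w = h w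
  obtain ⟨W, hW⟩ := (Set.toFinite {W | P W}).exists_maximal ⟨∅, fun _ => ⟨0, by simp⟩⟩
  refine ⟨W, ?_, fun f hf => ?_⟩
  · let r : z.range →ₗ[Dᵐᵒᵖ] (W → D) :=
      LinearMap.funLeft Dᵐᵒᵖ D ((↑) : W → V) ∘ₗ z.range.subtype
    have hr : Function.Surjective r := fun h => by
      obtain ⟨f, hf⟩ := hW.prop (Function.extend (↑) h 0)
      refine ⟨⟨z f, f, rfl⟩, funext fun w => ?_⟩
      exact (hf w w.2).trans (Subtype.val_injective.extend_apply h 0 w)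
    have := r.finrank_range_le
    rw [LinearMap.range_eq_top.mpr hr, finrank_top] at this
    simpa [finrank_mulOpposite_fun] using this
  · by_contra hne
    obtain ⟨v, hv⟩ := Function.ne_iff.mp hne
    have hvW : v ∉ W := fun h => hv (hf v h)
    have hins : P (insert v W) := fun h => by
      obtain ⟨p, hp⟩ := hW.prop h
      refine ⟨p + MulOpposite.op ((z f v)⁻¹ * (h v - z p v)) • f, fun w hw => ?_⟩
      rw [map_add, map_smul, Pi.add_apply, Pi.smul_apply,
        op_smul_eq_mul]
      rcases Finset.mem_insert.mp hw with rfl | hw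
      · rw [mul_inv_cancel_left₀ hv, add_sub_cancel]
      · rw [hf w hw, zero_mul, add_zero, hp w hw]
    exact hvW (hW.le_of_ge hins (Finset.subset_insert v W) (Finset.mem_insert_self v W))

end RightModule

section Sofic

open Module Filter

/-- The right-linear combination of the pullbacks along the maps `p k`, with coefficients acting
by left multiplication. -/
def pullbackCombination {D κ V : Type*} [DivisionRing D] (s : Finset κ) (a : κ → D)
    (p : κ → V → V) : Module.End Dᵐᵒᵖ (V → D) :=
  ∑ k ∈ s, Module.toModuleEnd Dᵐᵒᵖ (V → D) (a k) * LinearMap.funLeft Dᵐᵒᵖ D (p k)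

theorem pullbackCombination_apply {D κ V : Type*} [DivisionRing D] (s : Finset κ) (a : κ → D)
    (p : κ → V → V) (f : V → D) (v : V) :
    pullbackCombination s a p f v = ∑ k ∈ s, a k * f (p k v) := by
  simp [pullbackCombination, LinearMap.sum_apply, LinearMap.funLeft_apply]

theorem ncard_le_card_mul_finrank_range_pullbackCombination {D κ V : Type*} [DivisionRing D]
    [Finite V] {s : Finset κ} {a : κ → D} {k₀ : κ} (hk₀ : k₀ ∈ s) (ha : a k₀ ≠ 0)
    (p : κ → V → V) (ψ : V → V) :
    {v | ψ (p k₀ v) = v ∧ ∀ k ∈ s, k ≠ k₀ → p k v ≠ p k₀ v}.ncard ≤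
      s.card * finrank Dᵐᵒᵖ (pullbackCombination s a p).range := by
  classical
  obtain ⟨W, hcard, hW⟩ := (pullbackCombination s a p).exists_card_le_finrank_range
  let X : Finset V := W.biUnion fun w => s.image fun k => p k w
  have hX : X.card ≤ s.card * finrank Dᵐᵒᵖ (pullbackCombination s a p).range :=
    calc X.card ≤ W.card * s.card :=
          Finset.card_biUnion_le_card_mul _ _ _ fun w _ => Finset.card_image_le
      _ ≤ _ := by rw [mul_comm]; gcongr
  refine le_trans ?_ hX
  rw [← Set.ncard_coe_finset]
  refine Set.ncard_le_ncard_of_injOn (p k₀) ?_ ?_ (Finset.finite_toSet X)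
  · rintro v ⟨-, hv⟩
    by_contra hvX
    have hvX' : ∀ w ∈ W, ∀ k ∈ s, p k w ≠ p k₀ v := fun w hw k hk h =>
      hvX (Finset.mem_coe.mpr (Finset.mem_biUnion.mpr ⟨w, hw, Finset.mem_image.mpr ⟨k, hk, h⟩⟩))
    have h₀ := congr_fun (hW (Pi.single (p k₀ v) 1) fun w hw => by
      rw [pullbackCombination_apply]
      exact Finset.sum_eq_zero fun k hk => by rw [Pi.single_eq_of_ne (hvX' w hw k hk), mul_zero]) v
    rw [pullbackCombination_apply, Finset.sum_eq_single_of_mem k₀ hk₀ fun k hk hne => by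
      rw [Pi.single_eq_of_ne (hv k hk hne), mul_zero], Pi.single_eq_same, mul_one] at h₀
    exact ha h₀
  · rintro v ⟨hv, -⟩ w ⟨hw, -⟩ h
    rw [← hv, ← hw, h]

/-- A family of approximate actions on finite sets whose defects vanish along an ultrafilter. -/
theorem IsSofic.exists_ultrafilter {G : Type*} [Group G] (hG : IsSofic G) :
    ∃ (ω : Ultrafilter (Finset G × ℕ)) (V : Finset G × ℕ → Type) (_ : ∀ i, Finite (V i))
      (_ : ∀ i, Nonempty (V i)) (φ : ∀ i, G → V i → V i), ∀ ε : ℝ, 0 < ε →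
        (∀ e f, ∀ᶠ i in (ω : Filter _),
          ({v | φ i (e * f) v ≠ φ i e (φ i f v)}.ncard : ℝ) ≤ ε * Nat.card (V i)) ∧
        (∀ᶠ i in (ω : Filter _), ({v | φ i 1 v ≠ v}.ncard : ℝ) ≤ ε * Nat.card (V i)) ∧
        (∀ e, e ≠ 1 → ∀ᶠ i in (ω : Filter _),
          ({v | φ i e v = v}.ncard : ℝ) ≤ ε * Nat.card (V i)) := by
  classical
  have hn : ∀ n : ℕ, (0 : ℝ) < 1 / (n + 2) ∧ (1 : ℝ) / (n + 2) < 1 := fun n =>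
    ⟨by positivity, by rw [div_lt_one (by positivity)]; linarith [n.cast_nonneg (α := ℝ)]⟩
  choose V hV hV' φ hφ using fun i : Finset G × ℕ => hG (1 / (i.2 + 2)) (hn i.2).1 (hn i.2).2 i.1
  let ω : Ultrafilter (Finset G × ℕ) := Ultrafilter.of atTop
  refine ⟨ω, V, fun i => inferInstance, hV', φ, fun ε hε => ?_⟩
  have key : ∀ F : Finset G, ∀ᶠ i in (ω : Filter (Finset G × ℕ)),
      F ⊆ i.1 ∧ ∀ n : ℕ, (1 / ((i.2 : ℝ) + 2)) * n ≤ ε * n := by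
    intro F
    obtain ⟨N, hN⟩ := exists_nat_one_div_lt hε
    filter_upwards [Ultrafilter.of_le atTop (eventually_ge_atTop (F, N))] with i hi
    refine ⟨hi.1, fun n => ?_⟩
    have hNi : (N : ℝ) ≤ i.2 := mod_cast hi.2
    gcongr
    refine le_trans ?_ hN.le
    gcongr
    linarith
  refine ⟨fun e f => ?_, ?_, fun e he => ?_⟩
  · filter_upwards [key {e, f}] with i hi
    exact ((hφ i).1 e (hi.1 (by simp)) f (hi.1 (by simp))).trans (hi.2 _)
  · filter_upwards [key ∅] with i hi
    exact (hφ i).2.1.trans (hi.2 _)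
  · filter_upwards [key {e}] with i hi
    exact ((hφ i).2.2 e (hi.1 (by simp)) he).le.trans (hi.2 _)

/-- Two families of pullbacks along maps that asymptotically agree have the same class. -/
theorem Filter.ringCon_mk'_rankIdeal_funLeft_eq {ι D : Type*} [DivisionRing D] {V : ι → Type*}
    [∀ i, Finite (V i)] {l : Filter ι} {p q : ∀ i, V i → V i}
    (h : ∀ ε : ℝ, 0 < ε → ∀ᶠ i in l, ({v | p i v ≠ q i v}.ncard : ℝ) ≤ ε * Nat.card (V i)) :
    (rankIdeal (fun i => V i → D) Dᵐᵒᵖ l).ringCon.mk' (fun i => LinearMap.funLeft Dᵐᵒᵖ D (p i)) =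
      (rankIdeal (fun i => V i → D) Dᵐᵒᵖ l).ringCon.mk'
        (fun i => LinearMap.funLeft Dᵐᵒᵖ D (q i)) := by
  have := fun i => Fintype.ofFinite (V i)
  rw [← sub_eq_zero, ← map_sub, ringCon_mk'_rankIdeal_eq_zero_iff, mem_rankIdeal]
  intro ε hε
  filter_upwards [h ε hε] with i hi
  rw [finrank_mulOpposite_fun]
  refine le_trans (Nat.cast_le.mpr ?_) hi
  refine Module.End.finrank_range_le_card_of_support fun f v hv => ?_
  have hv' : p i v = q i v := not_not.mp hv
  change f (p i v) - f (q i v) = 0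
  rw [hv', sub_self]

theorem finrank_range_pullbackCombination_of_approximate_action {G D V : Type*} [Group G]
    [DivisionRing D] [Finite V] {s : Finset G} {a : G → D} {g₀ : G} (hg₀ : g₀ ∈ s)
    (ha : a g₀ ≠ 0) (φ : G → V → V) {ε : ℝ}
    (hmul : ∀ g ∈ s, ({v | φ (g₀ * g⁻¹) v ≠ φ g₀ (φ g⁻¹ v)}.ncard : ℝ) ≤ ε * Nat.card V)
    (hone : ({v | φ 1 v ≠ v}.ncard : ℝ) ≤ ε * Nat.card V)
    (hne : ∀ g ∈ s, g ≠ g₀ → ({v | φ (g₀ * g⁻¹) v = v}.ncard : ℝ) ≤ ε * Nat.card V) :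
    (Nat.card V : ℝ) ≤
      s.card * finrank Dᵐᵒᵖ (pullbackCombination s a fun g => φ g⁻¹).range +
        (2 * s.card) * (ε * Nat.card V) := by
  classical
  have hgood := ncard_le_card_mul_finrank_range_pullbackCombination hg₀ ha (fun g => φ g⁻¹) (φ g₀)
  set A := {v | φ g₀ (φ g₀⁻¹ v) = v ∧ ∀ g ∈ s, g ≠ g₀ → φ g⁻¹ v ≠ φ g₀⁻¹ v}
  let B : G → Set V := fun g => {v | φ (g₀ * g⁻¹) v ≠ φ g₀ (φ g⁻¹ v)}
  let C : G → Set V := fun g => if g = g₀ then {v | φ 1 v ≠ v} else {v | φ (g₀ * g⁻¹) v = v}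
  have hcover : (Set.univ : Set V) ⊆ A ∪ ⋃ g ∈ s, (B g ∪ C g) := by
    intro v _
    by_contra hv
    have hv' : ∀ g ∈ s, v ∉ B g ∧ v ∉ C g := fun g hg =>
      not_or.mp fun h => hv (Or.inr (Set.mem_biUnion hg h))
    have hB : ∀ g ∈ s, φ (g₀ * g⁻¹) v = φ g₀ (φ g⁻¹ v) := fun g hg => not_not.mp (hv' g hg).1
    have hfix : φ g₀ (φ g₀⁻¹ v) = v := by
      have h := (hv' g₀ hg₀).2
      simp only [C, if_true] at h
      rw [← hB g₀ hg₀, mul_inv_cancel]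
      exact not_not.mp h
    refine hv (Or.inl ⟨hfix, fun g hg hgne h => (hv' g hg).2 ?_⟩)
    simp only [C, if_neg hgne]
    exact (hB g hg).trans (h ▸ hfix)
  have hBC : ∀ g ∈ s, ((B g ∪ C g).ncard : ℝ) ≤ 2 * (ε * Nat.card V) := by
    intro g hg
    have h₁ : ((B g ∪ C g).ncard : ℝ) ≤ (B g).ncard + (C g).ncard :=
      mod_cast Set.ncard_union_le _ _
    have h₂ : ((C g).ncard : ℝ) ≤ ε * Nat.card V := by
      by_cases h : g = g₀
      · simpa only [C, if_pos h] using hone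
      · simpa only [C, if_neg h] using hne g hg h
    linarith [hmul g hg]
  have hcard : Nat.card V ≤ A.ncard + ∑ g ∈ s, (B g ∪ C g).ncard := by
    rw [← Set.ncard_univ]
    exact (Set.ncard_le_ncard hcover).trans ((Set.ncard_union_le _ _).trans
      (Nat.add_le_add_left (s.set_ncard_biUnion_le _) _))
  have hsum : ∑ g ∈ s, ((B g ∪ C g).ncard : ℝ) ≤ s.card * (2 * (ε * Nat.card V)) := by
    simpa using Finset.sum_le_card_nsmul s _ _ hBC
  have hgood' : (A.ncard : ℝ) ≤
    s.card * finrank Dᵐᵒᵖ (pullbackCombination s a fun g => φ g⁻¹).range := mod_cast hgood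
  have hcard' : (Nat.card V : ℝ) ≤ A.ncard + ∑ g ∈ s, ((B g ∪ C g).ncard : ℝ) := mod_cast hcard
  linarith

end Sofic

/-- For a sofic group `G` and a division ring `D`, the group algebra `D(G)` embeds into a
von Neumann regular simple ring. -/
theorem monoidAlgebra_embeds_into_regular_simple_ring
    {G : Type u} [Group G] (hG : IsSofic G) (D : Type v) [DivisionRing D] :
    ∃ (R : Type (max u v)) (_ : Ring R) (T : MonoidAlgebra D G →+* R),
      Function.Injective T ∧
      (∀ x : R, ∃ y : R, x * y * x = x) ∧
      (∀ I : TwoSidedIdeal R, I = ⊥ ∨ I = ⊤) := by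
  obtain ⟨ω, V, hfin, hne, φ, hφ⟩ := hG.exists_ultrafilter
  let I := Filter.rankIdeal (fun i => V i → D) Dᵐᵒᵖ (ω : Filter (Finset G × ℕ))
  let q := I.ringCon.mk'
  let c : D →+* ∀ i, Module.End Dᵐᵒᵖ (V i → D) :=
    RingHom.pi fun i => Module.toModuleEnd Dᵐᵒᵖ (V i → D)
  let τ (g : G) (i : Finset G × ℕ) : Module.End Dᵐᵒᵖ (V i → D) :=
    LinearMap.funLeft Dᵐᵒᵖ D (φ i g⁻¹)
  let τ' : G →* I.ringCon.Quotient :=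
    { toFun := fun g => q (τ g)
      map_one' := by
        rw [← map_one q]
        refine Filter.ringCon_mk'_rankIdeal_funLeft_eq (q := fun i => id) fun ε hε => ?_
        rw [inv_one]
        exact (hφ ε hε).2.1
      map_mul' := fun g h => by
        rw [← map_mul q]
        refine Filter.ringCon_mk'_rankIdeal_funLeft_eq
          (q := fun i => φ i h⁻¹ ∘ φ i g⁻¹) fun ε hε => ?_
        rw [mul_inv_rev]
        exact (hφ ε hε).1 _ _ }
  let T : MonoidAlgebra D G →+* I.ringCon.Quotient :=
    MonoidAlgebra.liftNCRingHom (q.comp c) τ' fun d g => by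
      change q (c d) * q (τ g) = q (τ g) * q (c d)
      rw [← map_mul, ← map_mul]
      rfl
  have hT : ∀ a : MonoidAlgebra D G,
      T a = q fun i => pullbackCombination a.coeff.support a.coeff fun g => φ i g⁻¹ := by
    intro a
    have h : (fun i => pullbackCombination a.coeff.support a.coeff fun g => φ i g⁻¹) =
        ∑ g ∈ a.coeff.support, c (a.coeff g) * τ g := by
      ext1 i
      rw [Finset.sum_apply]
      rfl
    rw [h, map_sum]
    simp only [map_mul]
    rfl
  refine ⟨I.ringCon.Quotient, inferInstance, T, ?_,
    Filter.exists_mul_mul_self_quotient_rankIdeal _,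
    Filter.eq_bot_or_eq_top_quotient_rankIdeal ω⟩
  rw [injective_iff_map_eq_zero]
  intro a ha
  by_contra ha_ne
  rw [hT, Filter.ringCon_mk'_rankIdeal_eq_zero_iff, Filter.mem_rankIdeal] at ha
  obtain ⟨g₀, hg₀⟩ : a.coeff.support.Nonempty := by
    rw [Finsupp.support_nonempty_iff]
    exact fun h => ha_ne (MonoidAlgebra.ext h)
  set s := a.coeff.support
  have hpos : (0 : ℝ) < s.card := Nat.cast_pos.mpr (Finset.card_pos.mpr ⟨g₀, hg₀⟩)
  set ε : ℝ := 1 / (4 * s.card) with hε_def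
  have hε : 0 < ε := by positivity
  have hmul := (Filter.eventually_all_finset s).mpr fun g _ => (hφ ε hε).1 g₀ g⁻¹
  have hfree := (Filter.eventually_all_finset s).mpr fun g (_ : g ∈ s) =>
    Filter.eventually_imp_distrib_left.mpr fun h : g ≠ g₀ =>
      (hφ ε hε).2.2 (g₀ * g⁻¹) fun h' => h (mul_inv_eq_one.mp h').symm
  obtain ⟨i, h₁, h₂, h₃, h₄⟩ :=
    (hmul.and ((hφ ε hε).2.1.and (hfree.and (ha ε hε)))).exists
  have := Fintype.ofFinite (V i)
  have hle := finrank_range_pullbackCombination_of_approximate_action hg₀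
    (Finsupp.mem_support_iff.mp hg₀) (φ i) h₁ h₂ h₃
  rw [finrank_mulOpposite_fun] at h₄
  have hV : (0 : ℝ) < Nat.card (V i) := Nat.cast_pos.mpr Nat.card_pos
  have h₅ := mul_le_mul_of_nonneg_left h₄ hpos.le
  have h₆ : (s.card : ℝ) * (ε * Nat.card (V i)) = Nat.card (V i) / 4 := by
    rw [hε_def]
    field_simp
  linarith
end

section
/- Let G be a sofic group and D a division ring. Then the group algebra D(G) is directly finite: for all a, b in D(G), if a·b = 1 then b·a = 1. -/
open Finset in
/-- Greedy selection: a symmetric reflexive relation of degree at most `k` on a finite set `S`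
has an independent subset of cardinality at least `|S| / k`. -/
theorem exists_independent_subset {V : Type*} (S : Finset V) (r : V → V → Prop)
    (hrefl : ∀ v ∈ S, r v v) (hsymm : ∀ u v, r u v → r v u) (N : V → Finset V) (k : ℕ)
    (hN : ∀ u ∈ S, ∀ v ∈ S, r u v → v ∈ N u) (hk : ∀ u, #(N u) ≤ k) :
    ∃ U ⊆ S, (∀ u ∈ U, ∀ v ∈ U, r u v → u = v) ∧ #S ≤ #U * k := by
  classical
  have hne : (S.powerset.filter fun U => ∀ u ∈ U, ∀ v ∈ U, r u v → u = v).Nonempty :=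
    ⟨∅, by simp⟩
  obtain ⟨U, hU, hmax⟩ := Finset.exists_max_image _ Finset.card hne
  simp only [mem_filter, mem_powerset] at hU hmax
  refine ⟨U, hU.1, hU.2, ?_⟩
  have hsub : S ⊆ U.biUnion N := by
    intro v hv
    rw [mem_biUnion]
    by_cases hvU : v ∈ U
    · exact ⟨v, hvU, hN v hv v hv (hrefl v hv)⟩
    by_contra! hcon
    have hindep : ∀ u ∈ U, ¬ r u v := fun u hu h => hcon u hu (hN u (hU.1 hu) v hv h)
    have hle := hmax (insert v U) ⟨insert_subset hv hU.1, by
      intro u hu w hw h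
      rw [mem_insert] at hu hw
      rcases hu with rfl | hu <;> rcases hw with rfl | hw
      · rfl
      · exact absurd (hsymm _ _ h) (hindep w hw)
      · exact absurd h (hindep u hu)
      · exact hU.2 u hu w hw h⟩
    rw [card_insert_of_notMem hvU] at hle
    omega
  exact (card_le_card hsub).trans (card_biUnion_le_card_mul _ _ _ fun u _ => hk u)

section LinearAlgebra

variable {D W V : Type*} [DivisionRing D] [AddCommGroup W] [Module D W]

theorem LinearMap.finrank_range_one_sub_mul_le [FiniteDimensional D W] (X Y : Module.End D W) :
    Module.finrank D (range (1 - X * Y)) ≤ Module.finrank D (range (1 - Y * X)) := by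
  have hmaps : ∀ w ∈ ker (1 - Y * X), X w ∈ ker (1 - X * Y) := by
    intro w hw
    simp only [mem_ker, sub_apply, Module.End.one_apply, Module.End.mul_apply, sub_eq_zero] at hw ⊢
    rw [← hw]
  have hle := finrank_le_finrank_of_injective (f := X.restrict hmaps) (by
    rintro ⟨w, hw⟩ ⟨w', hw'⟩ h
    simp only [mem_ker, sub_apply, Module.End.one_apply, Module.End.mul_apply, sub_eq_zero] at hw hw'
    have h' : X w = X w' := congrArg Subtype.val h
    exact Subtype.ext (hw.trans ((congrArg Y h').trans hw'.symm)))
  have h₁ := (1 - X * Y).finrank_range_add_finrank_ker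
  have h₂ := (1 - Y * X).finrank_range_add_finrank_ker
  omega

theorem LinearMap.finrank_range_le_card_of_forall_notMem [Finite V] (T : W →ₗ[D] (V → D))
    (B : Finset V) (hB : ∀ f, ∀ v ∉ B, T f v = 0) : Module.finrank D (range T) ≤ B.card := by
  have hle := finrank_le_finrank_of_injective
    (f := (LinearMap.funLeft D D ((↑) : B → V)).domRestrict (range T)) (by
      rintro ⟨_, f, rfl⟩ ⟨_, f', rfl⟩ h
      refine Subtype.ext (funext fun v => ?_)
      by_cases hv : v ∈ B
      · exact congrFun h ⟨v, hv⟩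
      · exact (hB f v hv).trans (hB f' v hv).symm)
  simpa using hle

theorem LinearMap.card_le_finrank_range [Finite V] (T : W →ₗ[D] (V → D)) (U : Finset V)
    (f : V → W) (h₁ : ∀ u ∈ U, T (f u) u ≠ 0) (h₂ : ∀ u ∈ U, ∀ v ∈ U, u ≠ v → T (f u) v = 0) :
    U.card ≤ Module.finrank D (range T) := by
  have hli : LinearIndependent D fun u : U => T.rangeRestrict (f u) := by
    rw [Fintype.linearIndependent_iff]
    intro c hc v
    have hcv := congrFun (congrArg Subtype.val hc) v
    simp only [Submodule.coe_sum, Submodule.coe_smul, codRestrict_apply, Finset.sum_apply,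
      Pi.smul_apply, smul_eq_mul, rangeRestrict] at hcv
    rw [Finset.sum_eq_single v (fun u _ huv => by
      rw [h₂ u u.2 v v.2 fun h => huv (Subtype.ext h), mul_zero]) (by simp)] at hcv
    exact (mul_eq_zero.mp hcv).resolve_right (h₁ v v.2)
  simpa using hli.fintype_card_le_finrank

end LinearAlgebra

namespace MonoidAlgebra

variable {D G V : Type*} [DivisionRing D]

/-- The operator on functions `V → D` induced by an element of the group algebra and a map
`φ : G → Map(V)`; it sends `f` to `∑ g, (f ∘ φ g) * x g`. -/
noncomputable def soficOp (φ : G → V → V) (x : MonoidAlgebra D G) : Module.End D (V → D) where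
  toFun f v := x.coeff.sum fun g c => f (φ g v) * c
  map_add' f f' := by
    ext v
    simp [add_mul, Finsupp.sum_add]
  map_smul' d f := by
    ext v
    simp [mul_assoc, Finsupp.mul_sum]

theorem soficOp_apply (φ : G → V → V) (x : MonoidAlgebra D G) (f : V → D) (v : V) :
    soficOp φ x f v = x.coeff.sum fun g c => f (φ g v) * c := rfl

theorem soficOp_sub_apply (φ : G → V → V) (x y : MonoidAlgebra D G) (f : V → D) (v : V) :
    soficOp φ (x - y) f v = soficOp φ x f v - soficOp φ y f v := by
  simp only [soficOp_apply, coeff_sub]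
  exact Finsupp.sum_sub_index fun g c c' => mul_sub _ _ _

theorem soficOp_one_apply [Group G] (φ : G → V → V) (f : V → D) (v : V) :
    soficOp φ 1 f v = f (φ 1 v) := by
  simp [soficOp_apply, one_def]

theorem soficOp_mul_apply [Group G] (φ : G → V → V) (x y : MonoidAlgebra D G) (f : V → D) (v : V)
    (hv : ∀ g ∈ x.coeff.support, ∀ h ∈ y.coeff.support, φ (g * h) v = φ g (φ h v)) :
    soficOp φ (x * y) f v = (soficOp φ y * soficOp φ x) f v := by
  have hadd : ∀ (g : G) (c c' : D), f (φ g v) * (c + c') = f (φ g v) * c + f (φ g v) * c' :=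
    fun g c c' => mul_add _ _ _
  simp only [Module.End.mul_apply, soficOp_apply, mul_def, coeff_finsuppSum, coeff_single]
  rw [Finsupp.sum_sum_index (by simp) hadd]
  simp_rw [Finsupp.sum_mul]
  rw [Finsupp.sum_comm y.coeff x.coeff]
  refine Finset.sum_congr rfl fun g hg => ?_
  beta_reduce
  rw [Finsupp.sum_sum_index (by simp) hadd]
  refine Finset.sum_congr rfl fun h hh => ?_
  beta_reduce
  rw [Finsupp.sum_single_index (by simp), hv g hg h hh, mul_assoc]

end MonoidAlgebra

/-- In a sofic group, for every finite set `F` and every `δ > 0` there is a model in which all but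
a proportion `δ` of the points satisfy all the local conditions for `F`. -/
theorem IsSofic.exists_good_points {G : Type*} [Group G] (hG : IsSofic G) (F : Finset G) (n : ℕ) :
    ∃ (V : Type) (_ : Fintype V) (_ : Nonempty V) (φ : G → V → V) (B : Finset V),
      B.card * n < Fintype.card V ∧ ∀ v ∉ B,
        (∀ e ∈ F, ∀ f ∈ F, φ (e * f) v = φ e (φ f v)) ∧ φ 1 v = v ∧
          ∀ e ∈ F, e ≠ 1 → φ e v ≠ v := by
  classical
  set C : ℕ := F.card * F.card + 1 + F.card with hC
  have hpos : (0 : ℝ) < C * n + 2 := by positivity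
  obtain ⟨V, _, _, φ, ha, hb, hc⟩ := hG (1 / (C * n + 2)) (by positivity)
    (by rw [div_lt_one hpos]; have : (0 : ℝ) ≤ C * n := by positivity
        linarith) F
  set ε : ℝ := 1 / (C * n + 2) with hε
  let A (p : G × G) : Finset V := {v | φ (p.1 * p.2) v ≠ φ p.1 (φ p.2 v)}
  let I : Finset V := {v | φ 1 v ≠ v}
  let J (e : G) : Finset V := {v | φ e v = v}
  let F' := F.filter (· ≠ 1)
  refine ⟨V, ‹_›, ‹_›, φ, (F ×ˢ F).biUnion A ∪ I ∪ F'.biUnion J, ?_, ?_⟩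
  · have hA : ∀ p ∈ F ×ˢ F, ((A p).card : ℝ) ≤ ε * Fintype.card V := by
      intro p hp
      rw [Finset.mem_product] at hp
      simpa [A, Nat.card_eq_fintype_card, Fintype.card_subtype] using ha p.1 hp.1 p.2 hp.2
    have hI : (I.card : ℝ) ≤ ε * Fintype.card V := by
      simpa [I, Nat.card_eq_fintype_card, Fintype.card_subtype] using hb
    have hJ : ∀ e ∈ F', ((J e).card : ℝ) ≤ ε * Fintype.card V := by
      intro e he
      rw [Finset.mem_filter] at he
      simpa [J, Nat.card_eq_fintype_card, Fintype.card_subtype] using (hc e he.1 he.2).le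
    have hcard : (((F ×ˢ F).biUnion A ∪ I ∪ F'.biUnion J).card : ℝ) ≤
        ∑ p ∈ F ×ˢ F, ((A p).card : ℝ) + I.card + ∑ e ∈ F', ((J e).card : ℝ) := by
      have h₁ := Finset.card_union_le ((F ×ˢ F).biUnion A ∪ I) (F'.biUnion J)
      have h₂ := Finset.card_union_le ((F ×ˢ F).biUnion A) I
      have h₃ := Finset.card_biUnion_le (s := F ×ˢ F) (t := A)
      have h₄ := Finset.card_biUnion_le (s := F') (t := J)
      exact_mod_cast (by omega : _ ≤ ∑ p ∈ F ×ˢ F, (A p).card + I.card + ∑ e ∈ F', (J e).card)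
    have h₁ := Finset.sum_le_card_nsmul _ _ _ hA
    have h₂ := Finset.sum_le_card_nsmul _ _ _ hJ
    have hF' : (F'.card : ℝ) ≤ F.card := by exact_mod_cast Finset.card_filter_le _ _
    have hV : (0 : ℝ) < Fintype.card V := by exact_mod_cast Fintype.card_pos
    have hε0 : 0 < ε := by positivity
    have h₃ : (F'.card : ℝ) * (ε * Fintype.card V) ≤ F.card * (ε * Fintype.card V) := by gcongr
    simp only [Finset.card_product, nsmul_eq_mul, Nat.cast_mul] at h₁ h₂
    have hle : (((F ×ˢ F).biUnion A ∪ I ∪ F'.biUnion J).card : ℝ) ≤ C * (ε * Fintype.card V) := by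
      rw [hC]
      push_cast
      linarith
    have hlt : C * ε * n < 1 := by
      rw [hε, mul_one_div, div_mul_eq_mul_div, div_lt_one hpos]
      linarith
    have : (((F ×ˢ F).biUnion A ∪ I ∪ F'.biUnion J).card : ℝ) * n < Fintype.card V := calc
      _ ≤ C * (ε * Fintype.card V) * n := by gcongr
      _ = C * ε * n * Fintype.card V := by ring
      _ < 1 * Fintype.card V := by gcongr
      _ = _ := one_mul _
    exact_mod_cast this
  · intro v hv
    simp only [Finset.mem_union, Finset.mem_biUnion, Finset.mem_product, Finset.mem_filter,
      Finset.mem_univ, true_and, A, I, J, F', not_or, not_exists, not_and, not_not, Prod.forall]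
      at hv
    exact ⟨fun e he f hf => hv.1.1 e f ⟨he, hf⟩, hv.1.2, fun e he h1 => hv.2 e ⟨he, h1⟩⟩

/-- Kaplansky's direct finiteness conjecture for sofic groups: the group algebra of a
sofic group over a division ring is directly finite. -/
theorem monoidAlgebra_directFinite_of_sofic
    {G : Type*} [Group G] (hG : IsSofic G) (D : Type*) [DivisionRing D] :
    ∀ a b : MonoidAlgebra D G, a * b = 1 → b * a = 1 := by
  classical
  intro a b hab
  by_contra hba
  set z : MonoidAlgebra D G := 1 - b * a with hz
  have hz0 : z ≠ 0 := fun h => hba (sub_eq_zero.mp h).symm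
  obtain ⟨g₀, hg₀⟩ : z.coeff.support.Nonempty := by
    rw [Finsupp.support_nonempty_iff]
    simpa using hz0
  set E := z.coeff.support with hE
  set F : Finset G := a.coeff.support ∪ b.coeff.support ∪ E ∪ E.image (·⁻¹) ∪
    E.image (g₀⁻¹ * ·) with hF
  set k := E.card * E.card with hk
  obtain ⟨V, _, _, φ, B, hcard, hgood⟩ := hG.exists_good_points F (k + 1)
  have hEF : ∀ g ∈ E, g ∈ F := fun g hg => by simp [hF, hg]
  have hEF' : ∀ g ∈ E, g⁻¹ ∈ F := fun g hg => by simp [hF, hg]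
  have hinv : ∀ v ∉ B, ∀ g ∈ E, φ g⁻¹ (φ g v) = v := fun v hv g hg => by
    rw [← (hgood v hv).1 _ (hEF' g hg) _ (hEF g hg), inv_mul_cancel, (hgood v hv).2.1]
  have hdist : ∀ v ∉ B, ∀ g ∈ E, φ g v = φ g₀ v → g = g₀ := by
    intro v hv g hg h
    by_contra hne
    have hmem : g₀⁻¹ * g ∈ F := by
      rw [hF]
      exact Finset.mem_union_right _ (Finset.mem_image_of_mem _ hg)
    refine (hgood v hv).2.2 _ hmem (fun h1 => hne (inv_mul_eq_one.mp h1).symm) ?_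
    rw [(hgood v hv).1 _ (hEF' _ hg₀) _ (hEF g hg), h, hinv v hv g₀ hg₀]
  obtain ⟨U, hUB, hUindep, hUcard⟩ := exists_independent_subset Bᶜ
    (fun u v => ∃ g ∈ E, ∃ h ∈ E, φ g u = φ h v)
    (fun v _ => ⟨g₀, hg₀, g₀, hg₀, rfl⟩)
    (fun u v ⟨g, hg, h, hh, e⟩ => ⟨h, hh, g, hg, e.symm⟩)
    (fun u => (E ×ˢ E).image fun p => φ p.2⁻¹ (φ p.1 u)) k
    (by
      rintro u - v hv ⟨g, hg, h, hh, e⟩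
      refine Finset.mem_image.mpr ⟨(g, h), Finset.mem_product.mpr ⟨hg, hh⟩, ?_⟩
      simp only [e]
      exact hinv v (Finset.mem_compl.mp hv) h hh)
    (fun u => Finset.card_image_le.trans (Finset.card_product _ _).le)
  let S := MonoidAlgebra.soficOp (D := D) φ
  have hupper : Module.finrank D (LinearMap.range (1 - S b * S a)) ≤ B.card := by
    refine LinearMap.finrank_range_le_card_of_forall_notMem _ B fun f v hv => ?_
    rw [LinearMap.sub_apply, Pi.sub_apply, ← MonoidAlgebra.soficOp_mul_apply φ a b f v
      fun g hg h hh => (hgood v hv).1 g (by simp [hF, hg, -Finsupp.mem_support_iff])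
        h (by simp [hF, hh, -Finsupp.mem_support_iff]),
      hab, MonoidAlgebra.soficOp_one_apply, (hgood v hv).2.1]
    exact sub_self _
  have hagree : ∀ f, ∀ v ∉ B, (1 - S a * S b) f v = z.coeff.sum fun g c => f (φ g v) * c := by
    intro f v hv
    rw [← MonoidAlgebra.soficOp_apply, hz, MonoidAlgebra.soficOp_sub_apply,
      MonoidAlgebra.soficOp_one_apply, (hgood v hv).2.1, MonoidAlgebra.soficOp_mul_apply φ b a f v
      fun g hg h hh => (hgood v hv).1 g (by simp [hF, hg, -Finsupp.mem_support_iff])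
        h (by simp [hF, hh, -Finsupp.mem_support_iff])]
    rfl
  have hlower : U.card ≤ Module.finrank D (LinearMap.range (1 - S a * S b)) := by
    refine LinearMap.card_le_finrank_range _ U (fun u => Pi.single (φ g₀ u) 1) ?_ ?_
    · intro u hu
      have huB := Finset.mem_compl.mp (hUB hu)
      rw [hagree _ u huB, Finsupp.sum, Finset.sum_eq_single g₀]
      · simpa using Finsupp.mem_support_iff.mp hg₀
      · intro g hg hne
        rw [Pi.single_eq_of_ne fun h => hne (hdist u huB g hg h), zero_mul]
      · exact fun h => absurd hg₀ h
    · intro u hu v hv huv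
      rw [hagree _ v (Finset.mem_compl.mp (hUB hv))]
      refine Finset.sum_eq_zero fun g hg => ?_
      beta_reduce
      rw [Pi.single_eq_of_ne fun h => huv (hUindep u hu v hv ⟨g₀, hg₀, g, hg, h.symm⟩), zero_mul]
  have hUle := (hlower.trans (LinearMap.finrank_range_one_sub_mul_le (S a) (S b))).trans hupper
  have hcompl := Finset.card_compl_add_card B
  have := Nat.mul_le_mul_right k hUle
  rw [mul_add, mul_one] at hcard
  omega
end

section
/- Let G be a sofic group and D a division ring. Then the group algebra D(G) is stably finite: for every natural number n and all n×n matrices a, b over D(G), if a·b = 1 then b·a = 1. -/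
open Finset in
/-- Sofic approximations as almost right actions, with the exceptional points collected in a set
whose proportion is as small as desired. -/
theorem IsSofic.exists_almost_right_action {G : Type*} [Group G] (hG : IsSofic G)
    (F : Finset G) (k : ℕ) :
    ∃ (V : Type) (_ : Fintype V) (ψ : G → V → V) (bad : Finset V),
      k * #bad < Fintype.card V ∧ ∀ v ∉ bad,
        (∀ g ∈ F, ∀ h ∈ F, ψ (g * h) v = ψ h (ψ g v)) ∧ ψ 1 v = v ∧
          ∀ g ∈ F, g ≠ 1 → ψ g v ≠ v := by
  classical
  set E : Finset G := F.image (·⁻¹)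
  set m : ℕ := #E * #E + 1 + #E
  set ε : ℝ := 1 / (k * m + 2)
  have hpos : (0 : ℝ) < k * m + 2 := by positivity
  obtain ⟨V, _, _, φ, hmul, hone, hfix⟩ := hG ε (by positivity)
    (by rw [div_lt_one hpos]; linarith [show (0 : ℝ) ≤ k * m by positivity]) E
  have card_eq (p : V → Prop) [DecidablePred p] : Nat.card {v : V | p v} = #{v | p v} := by
    simp [Fintype.card_subtype]
  simp only [card_eq, Nat.card_eq_fintype_card] at hmul hone hfix
  set N : ℝ := (Fintype.card V : ℝ) with hN
  have hNpos : 0 < N := by simp [hN, Fintype.card_pos]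
  set badMul : Finset V :=
    (E ×ˢ E).biUnion fun p ↦ {v | φ (p.1 * p.2) v ≠ φ p.1 (φ p.2 v)}
  set badOne : Finset V := {v | φ 1 v ≠ v}
  set badFix : Finset V := (E.filter (· ≠ 1)).biUnion fun e ↦ {v | φ e v = v}
  have hbadMul : (#badMul : ℝ) ≤ (#E * #E : ℕ) * (ε * N) := by
    calc (#badMul : ℝ) ≤ ∑ p ∈ E ×ˢ E, (#{v | φ (p.1 * p.2) v ≠ φ p.1 (φ p.2 v)} : ℝ) :=
          mod_cast card_biUnion_le
      _ ≤ ∑ _p ∈ E ×ˢ E, ε * N := sum_le_sum fun p hp ↦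
          hmul _ (mem_product.1 hp).1 _ (mem_product.1 hp).2
      _ = _ := by simp
  have hbadFix : (#badFix : ℝ) ≤ #E * (ε * N) := by
    calc (#badFix : ℝ) ≤ ∑ e ∈ E.filter (· ≠ 1), (#{v | φ e v = v} : ℝ) :=
          mod_cast card_biUnion_le
      _ ≤ ∑ _e ∈ E.filter (· ≠ 1), ε * N := sum_le_sum fun e he ↦
          (hfix e (mem_filter.1 he).1 (mem_filter.1 he).2).le
      _ = #(E.filter (· ≠ 1)) * (ε * N) := by simp
      _ ≤ _ := by gcongr; exact filter_subset _ _
  refine ⟨V, inferInstance, fun g ↦ φ g⁻¹, badMul ∪ badOne ∪ badFix, ?_, fun v hv ↦ ?_⟩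
  · have hbad : (#(badMul ∪ badOne ∪ badFix) : ℝ) ≤ m * (ε * N) := by
      have : (#(badMul ∪ badOne ∪ badFix) : ℝ) ≤ #badMul + #badOne + #badFix := by
        exact_mod_cast (card_union_le _ _).trans (Nat.add_le_add_right (card_union_le _ _) _)
      have hm : (m : ℝ) = (#E * #E : ℕ) + 1 + #E := by simp [m]
      rw [hm]
      linarith
    have hlt : (k : ℝ) * #(badMul ∪ badOne ∪ badFix) < N := by
      calc (k : ℝ) * #(badMul ∪ badOne ∪ badFix) ≤ k * (m * (ε * N)) := by gcongr
        _ = (k * m) / (k * m + 2) * N := by simp only [ε]; ring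
        _ < 1 * N := by
          gcongr
          rw [div_lt_one hpos]
          linarith
        _ = N := one_mul N
    rw [hN] at hlt
    exact_mod_cast hlt
  · simp only [mem_union, not_or] at hv
    obtain ⟨⟨hv₁, hv₂⟩, hv₃⟩ := hv
    refine ⟨fun g hg h hh ↦ ?_, by simpa [badOne] using hv₂, fun g hg hne heq ↦ hv₃ ?_⟩
    · by_contra hne
      refine hv₁ (mem_biUnion.2 ⟨(h⁻¹, g⁻¹), ?_, ?_⟩)
      · exact mem_product.2 ⟨mem_image_of_mem _ hh, mem_image_of_mem _ hg⟩
      · simpa using hne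
    · exact mem_biUnion.2 ⟨g⁻¹, by simp [E, hg, hne], by simpa using heq⟩

/-- A subspace of dimension `r` in a coordinate space embeds into some `r` coordinates. -/
theorem Submodule.exists_finset_card_le_finrank_forall_eq_zero {D ι : Type*} [DivisionRing D]
    [Finite ι] (W : Submodule D (ι → D)) :
    ∃ R : Finset ι, R.card ≤ Module.finrank D W ∧
      ∀ w ∈ W, (∀ x ∈ R, w x = 0) → w = 0 := by
  classical
  induction hr : Module.finrank D W using Nat.strong_induction_on generalizing W with
  | _ r ih =>
    obtain rfl | hW := eq_or_ne W ⊥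
    · exact ⟨∅, by simp, fun w hw _ ↦ by simpa using hw⟩
    obtain ⟨w, hw, hne⟩ := W.exists_mem_ne_zero_of_ne_bot hW
    obtain ⟨x, hx⟩ := Function.ne_iff.1 hne
    set W' := W ⊓ LinearMap.ker (LinearMap.proj x : (ι → D) →ₗ[D] D)
    have hlt : W' < W := lt_of_le_of_ne inf_le_left fun h ↦ hx (h ▸ hw : w ∈ W').2
    have hrank := Submodule.finrank_lt_finrank_of_lt hlt
    obtain ⟨R, hR, hR'⟩ := ih _ (hr ▸ hrank) W' rfl
    refine ⟨insert x R, by grind [Finset.card_insert_le x R], fun u hu h ↦ ?_⟩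
    exact hR' u ⟨hu, h x (by simp)⟩ fun y hy ↦ h y (by simp [hy])

/-- If the range of an endomorphism contains all but `r` of the standard basis vectors, then its
kernel has dimension at most `r`. -/
theorem LinearMap.finrank_ker_le_card_of_single_mem_range {D ι : Type*} [DivisionRing D]
    [Fintype ι] [DecidableEq ι] (f : (ι → D) →ₗ[D] (ι → D)) (P : Finset ι)
    (h : ∀ p ∉ P, Pi.single p 1 ∈ LinearMap.range f) :
    Module.finrank D (LinearMap.ker f) ≤ P.card := by
  classical
  set S := Submodule.span D ((P.image fun p ↦ (Pi.single p 1 : ι → D) : Finset (ι → D)) :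
    Set (ι → D))
  have hS : Module.finrank D S ≤ P.card :=
    (finrank_span_finset_le_card _).trans Finset.card_image_le
  have htop : LinearMap.range f ⊔ S = ⊤ := by
    rw [eq_top_iff, ← (Pi.basisFun D ι).span_eq, Submodule.span_le]
    rintro _ ⟨p, rfl⟩
    rw [Pi.basisFun_apply]
    by_cases hp : p ∈ P
    · exact Submodule.mem_sup_right (Submodule.subset_span (by
        simpa using ⟨p, hp, rfl⟩))
    · exact Submodule.mem_sup_left (h p hp)
  have h₁ := Submodule.finrank_add_le_finrank_add_finrank (LinearMap.range f) S
  have h₂ := f.finrank_range_add_finrank_ker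
  rw [htop, finrank_top] at h₁
  omega

namespace MonoidAlgebra

/-- Pushing elements of a monoid algebra forward along the orbit map of `v` is multiplicative as
long as `ψ` behaves like a right action at `v` on the supports. -/
theorem mapDomain_mul_apply_of_forall_mem_support {M V D : Type*} [Monoid M] [Semiring D]
    [Fintype V] (ψ : M → V → V) (v w : V) (a b : MonoidAlgebra D M)
    (h : ∀ g ∈ a.coeff.support, ∀ h ∈ b.coeff.support, ψ (g * h) v = ψ h (ψ g v)) :
    Finsupp.mapDomain (ψ · v) (a * b).coeff w =
      ∑ u, Finsupp.mapDomain (ψ · v) a.coeff u * Finsupp.mapDomain (ψ · u) b.coeff w := by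
  classical
  have hR : ∑ u, Finsupp.mapDomain (ψ · v) a.coeff u * Finsupp.mapDomain (ψ · u) b.coeff w =
      (Finsupp.mapDomain (ψ · v) a.coeff).sum
        fun u r ↦ r * Finsupp.mapDomain (ψ · u) b.coeff w :=
    (Finsupp.sum_fintype _ (fun u r ↦ r * Finsupp.mapDomain (ψ · u) b.coeff w)
      fun _ ↦ zero_mul _).symm
  rw [hR, Finsupp.sum_mapDomain_index (fun _ ↦ zero_mul _) fun _ _ _ ↦ add_mul _ _ _, mul_def]
  simp only [Finsupp.sum, coeff_sum, coeff_single, Finsupp.mapDomain_finsetSum,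
    Finsupp.mapDomain_single, Finsupp.finsetSum_apply]
  refine Finset.sum_congr rfl fun g hg ↦ ?_
  simp only [Finsupp.mapDomain, Finsupp.sum, Finsupp.finsetSum_apply, Finset.mul_sum]
  refine Finset.sum_congr rfl fun k hk ↦ ?_
  rw [h g hg k hk]
  rw [Finsupp.single_apply, Finsupp.single_apply, mul_ite, mul_zero]

/-- The matrix over `D` obtained from a matrix over the monoid algebra by letting the monoid act
on `V` (on the right) through `ψ`. -/
noncomputable def orbitMatrix {M V D m n : Type*} [Semiring D] (ψ : M → V → V)
    (A : Matrix m n (MonoidAlgebra D M)) : Matrix (m × V) (n × V) D :=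
  fun p q ↦ Finsupp.mapDomain (ψ · p.2) (A p.1 q.1).coeff q.2

theorem orbitMatrix_mul_row {M V D l m n : Type*} [Monoid M] [Semiring D] [Fintype V] [Fintype m]
    (ψ : M → V → V) (A : Matrix l m (MonoidAlgebra D M)) (B : Matrix m n (MonoidAlgebra D M))
    (i : l) (v : V)
    (h : ∀ i j, ∀ g ∈ (A i j).coeff.support, ∀ i' j', ∀ h ∈ (B i' j').coeff.support,
      ψ (g * h) v = ψ h (ψ g v)) :
    orbitMatrix ψ (A * B) (i, v) = (orbitMatrix ψ A * orbitMatrix ψ B) (i, v) := by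
  ext ⟨j, w⟩
  simp only [orbitMatrix, Matrix.mul_apply, coeff_sum, Finsupp.mapDomain_finsetSum,
    Finsupp.finsetSum_apply, Fintype.sum_prod_type]
  refine Finset.sum_congr rfl fun k _ ↦ ?_
  exact mapDomain_mul_apply_of_forall_mem_support ψ v w _ _ fun g hg k' hk' ↦
    h _ _ g hg _ _ k' hk'

theorem orbitMatrix_one_row {M V D n : Type*} [Monoid M] [Semiring D] [DecidableEq V]
    [DecidableEq n] (ψ : M → V → V) (i : n) (v : V) (h : ψ 1 v = v) :
    orbitMatrix ψ (1 : Matrix n n (MonoidAlgebra D M)) (i, v) = Pi.single (i, v) 1 := by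
  ext ⟨j, w⟩
  by_cases hij : i = j
  · subst hij
    simp [orbitMatrix, one_def, h, Pi.single_apply, Finsupp.single_apply, eq_comm]
  · simp [orbitMatrix, Matrix.one_apply_ne hij, Ne.symm hij]

end MonoidAlgebra

/-- The group algebra of a sofic group over a division ring is stably finite. -/
theorem monoidAlgebra_stablyFinite_of_sofic
    {G : Type*} [Group G] (hG : IsSofic G) (D : Type*) [DivisionRing D] :
    ∀ (n : ℕ) (a b : Matrix (Fin n) (Fin n) (MonoidAlgebra D G)),
      a * b = 1 → b * a = 1 := by
  classical
  intro n A B hAB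
  by_contra hBA
  set C := 1 - B * A with hC
  have hCB : C * B = 0 := by rw [hC, sub_mul, mul_assoc, hAB, one_mul, mul_one, sub_self]
  obtain ⟨i, j, hij⟩ : ∃ i j, C i j ≠ 0 := by
    by_contra! h
    exact hBA (sub_eq_zero.1 (Matrix.ext h : C = 0)).symm
  obtain ⟨g₀, hg₀⟩ := Finsupp.support_nonempty_iff.2 (MonoidAlgebra.coeff_eq_zero.not.2 hij)
  let supp (X : Matrix (Fin n) (Fin n) (MonoidAlgebra D G)) : Finset G :=
    Finset.univ.biUnion fun p : Fin n × Fin n ↦ (X p.1 p.2).coeff.support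
  have mem_supp X i j g (h : g ∈ (X i j).coeff.support) : g ∈ supp X :=
    Finset.mem_biUnion.2 ⟨(i, j), Finset.mem_univ _, h⟩
  set S := supp A ∪ supp B ∪ supp C
  have hA : supp A ⊆ S := fun g hg ↦ by simp [S, hg]
  have hB : supp B ⊆ S := fun g hg ↦ by simp [S, hg]
  have hC' : supp C ⊆ S := fun g hg ↦ by simp [S, hg]
  set F := S ∪ S.image (·⁻¹) ∪ Finset.image₂ (fun g h ↦ g * h⁻¹) S S
  have hSF : S ⊆ F := fun g hg ↦ by simp [F, hg]
  have hinv {g} (hg : g ∈ S) : g⁻¹ ∈ F := by simp [F, hg]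
  have hdiv {g h} (hg : g ∈ S) (hh : h ∈ S) : g * h⁻¹ ∈ F :=
    Finset.mem_union_right _ (Finset.mem_image₂_of_mem hg hh)
  obtain ⟨V, _, ψ, bad, hbad, hgood⟩ := hG.exists_almost_right_action F (S.card * n + 1)
  have hcancel {v} (hv : v ∉ bad) {g} (hg : g ∈ S) : ψ g⁻¹ (ψ g v) = v := by
    rw [← (hgood v hv).1 g (hSF hg) g⁻¹ (hinv hg), mul_inv_cancel, (hgood v hv).2.1]
  have hinj {v} (hv : v ∉ bad) : Set.InjOn (ψ · v) S := by
    intro g hg h hh heq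
    simp only at heq
    by_contra hne
    refine (hgood v hv).2.2 (g * h⁻¹) (hdiv hg hh) (by rwa [Ne, mul_inv_eq_one]) ?_
    rw [(hgood v hv).1 g (hSF hg) h⁻¹ (hinv hh), heq, hcancel hv hh]
  have hrow {X Y : Matrix (Fin n) (Fin n) (MonoidAlgebra D G)} (hX : supp X ⊆ S)
      (hY : supp Y ⊆ S) (i : Fin n) {v} (hv : v ∉ bad) :
      MonoidAlgebra.orbitMatrix ψ (X * Y) (i, v) =
        (MonoidAlgebra.orbitMatrix ψ Y).toLinearMapRight'
          (MonoidAlgebra.orbitMatrix ψ X (i, v)) := by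
    rw [MonoidAlgebra.orbitMatrix_mul_row ψ X Y i v fun _ _ g hg _ _ h hh ↦
      (hgood v hv).1 g (hSF (hX (mem_supp _ _ _ _ hg))) h (hSF (hY (mem_supp _ _ _ _ hh)))]
    rfl
  set f := (MonoidAlgebra.orbitMatrix ψ B).toLinearMapRight'
  have hker := f.finrank_ker_le_card_of_single_mem_range (Finset.univ ×ˢ bad) fun p hp ↦ by
    obtain ⟨i, v⟩ := p
    have hv : v ∉ bad := by simpa using hp
    refine ⟨MonoidAlgebra.orbitMatrix ψ A (i, v), ?_⟩
    rw [← hrow hA hB i hv, hAB, MonoidAlgebra.orbitMatrix_one_row ψ i v (hgood v hv).2.1]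
  obtain ⟨R, hR, hR'⟩ := (LinearMap.ker f).exists_finset_card_le_finrank_forall_eq_zero
  have hmeet (v) (hv : v ∉ bad) : ∃ g ∈ S, ∃ k, (k, ψ g v) ∈ R := by
    have hmem : MonoidAlgebra.orbitMatrix ψ C (i, v) ∈ LinearMap.ker f := by
      rw [LinearMap.mem_ker, ← hrow hC' hB i hv, hCB]
      ext
      simp [MonoidAlgebra.orbitMatrix]
    have hne : MonoidAlgebra.orbitMatrix ψ C (i, v) ≠ 0 := fun h ↦ by
      have h₀ := congrFun h (j, ψ g₀ v)
      rw [MonoidAlgebra.orbitMatrix, Finsupp.mapDomain_apply' (S : Set G) _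
        (fun g hg ↦ hC' (mem_supp C i j g hg)) (hinj hv) (hC' (mem_supp C i j g₀ hg₀))] at h₀
      exact Finsupp.mem_support_iff.1 hg₀ h₀
    obtain ⟨⟨k, u⟩, hkR, hku⟩ : ∃ x ∈ R, MonoidAlgebra.orbitMatrix ψ C (i, v) x ≠ 0 := by
      by_contra! h
      exact hne (hR' _ hmem h)
    obtain ⟨g, hg, rfl⟩ := Finset.mem_image.1
      (Finsupp.mapDomain_support (Finsupp.mem_support_iff.2 hku))
    exact ⟨g, hC' (mem_supp C i k g hg), k, hkR⟩
  have : Nonempty (Fin n) := ⟨i⟩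
  choose! γ hγ κ hκ using hmeet
  have hcard : badᶜ.card ≤ (S ×ˢ R).card := by
    refine Finset.card_le_card_of_injOn (fun v ↦ (γ v, (κ v, ψ (γ v) v))) (fun v hv ↦ ?_) ?_
    · have hv' : v ∉ bad := by simpa using hv
      simpa using ⟨hγ v hv', hκ v hv'⟩
    · intro v hv w hw h
      have hv' : v ∉ bad := by simpa using hv
      have hw' : w ∉ bad := by simpa using hw
      simp only [Prod.mk.injEq] at h
      rw [← hcancel hv' (hγ v hv'), h.2.2, h.1, hcancel hw' (hγ w hw')]
  have hRcard : R.card ≤ n * bad.card := by simpa using hR.trans hker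
  rw [Finset.card_product, Finset.card_compl] at hcard
  have := Nat.mul_le_mul_left S.card hRcard
  rw [← mul_assoc] at this
  rw [add_mul, one_mul] at hbad
  omega
end

section
/- Let I be a set, ω an ultrafilter on I, D a division ring, and (A_α)_{α∈I} a family of nonzero finite-dimensional D-vector spaces. Let E = ∏_{α∈I} End_D(A_α) be the product ring. Suppose N : E → ℝ is a function such that for every r = (r_α) in E, the function α ↦ rank(r_α)/dim(A_α) converges to N(r) along ω. Then N is a pseudo-rank function on E: (a) N(1) = 1 and N(0) = 0; (b) N(r·s) ≤ N(r) and N(r·s) ≤ N(s) for all r, s in E; (c) N(e + f) = N(e) + N(f) whenever e, f in E are orthogonal idempotents (e·e = e, f·f = f, e·f = 0, f·e = 0). Moreover 0 ≤ N(r) ≤ 1 for all r in E. -/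
open Filter

namespace LinearMap

variable {D V : Type*} [DivisionRing D] [AddCommGroup V] [Module D V]

theorem range_add_of_isIdempotentElem {e f : Module.End D V}
    (he : e * e = e) (hf : f * f = f) (hef : e * f = 0) (hfe : f * e = 0) :
    range (e + f) = range e ⊔ range f := by
  apply le_antisymm
  · rintro _ ⟨x, rfl⟩
    exact Submodule.add_mem_sup ⟨x, rfl⟩ ⟨x, rfl⟩
  · apply sup_le
    · rintro _ ⟨x, rfl⟩
      refine ⟨e x, ?_⟩
      change (e * e) x + (f * e) x = e x
      simp [he, hfe]
    · rintro _ ⟨x, rfl⟩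
      refine ⟨f x, ?_⟩
      change (e * f) x + (f * f) x = f x
      simp [hf, hef]

theorem disjoint_range_of_isIdempotentElem {e f : Module.End D V}
    (he : e * e = e) (hef : e * f = 0) : Disjoint (range e) (range f) := by
  rw [Submodule.disjoint_def]
  rintro _ ⟨x, rfl⟩ ⟨y, hy⟩
  calc e x = (e * e) x := by rw [he]
    _ = e (f y) := by rw [hy]; rfl
    _ = (e * f) y := rfl
    _ = 0 := by rw [hef]; rfl

theorem finrank_range_add_of_isIdempotentElem [FiniteDimensional D V] {e f : Module.End D V}
    (he : e * e = e) (hf : f * f = f) (hef : e * f = 0) (hfe : f * e = 0) :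
    Module.finrank D (range (e + f)) =
      Module.finrank D (range e) + Module.finrank D (range f) := by
  rw [range_add_of_isIdempotentElem he hf hef hfe, ← Submodule.finrank_sup_add_finrank_inf_eq,
    (disjoint_range_of_isIdempotentElem he hef).eq_bot, finrank_bot, add_zero]

end LinearMap

/-- The normalized-rank ultralimit is a pseudo-rank function on the direct product
of the endomorphism rings of a family of nonzero finite-dimensional vector spaces
over a division ring. -/
theorem pseudoRank_of_ultralimit
    {I : Type*} (ω : Ultrafilter I) {D : Type*} [DivisionRing D]
    (A : I → Type*) [∀ α, AddCommGroup (A α)] [∀ α, Module D (A α)]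
    [∀ α, FiniteDimensional D (A α)] (hA : ∀ α, Nontrivial (A α))
    (N : (∀ α, Module.End D (A α)) → ℝ)
    (hN : ∀ r : ∀ α, Module.End D (A α),
      Tendsto
        (fun α => (Module.finrank D (LinearMap.range (r α)) : ℝ) / Module.finrank D (A α))
        (ω : Filter I) (nhds (N r))) :
    (N 1 = 1 ∧ N 0 = 0) ∧
    (∀ r s : ∀ α, Module.End D (A α), N (r * s) ≤ N r ∧ N (r * s) ≤ N s) ∧
    (∀ e f : ∀ α, Module.End D (A α),
      e * e = e → f * f = f → e * f = 0 → f * e = 0 → N (e + f) = N e + N f) ∧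
    (∀ r : ∀ α, Module.End D (A α), 0 ≤ N r ∧ N r ≤ 1) := by
  have hpos : ∀ α, (0 : ℝ) < Module.finrank D (A α) := fun α => by
    have := hA α
    exact_mod_cast Module.finrank_pos
  refine ⟨⟨?_, ?_⟩, fun r s => ⟨?_, ?_⟩, fun e f he hf hef hfe => ?_, fun r => ⟨?_, ?_⟩⟩
  · refine tendsto_nhds_unique (hN 1) (tendsto_const_nhds.congr fun α => ?_)
    rw [Pi.one_apply, Module.End.one_eq_id, LinearMap.range_id, finrank_top,
      div_self (hpos α).ne']
  · refine tendsto_nhds_unique (hN 0) (tendsto_const_nhds.congr fun α => ?_)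
    rw [Pi.zero_apply, LinearMap.range_zero, finrank_bot, Nat.cast_zero, zero_div]
  · refine le_of_tendsto_of_tendsto' (hN (r * s)) (hN r) fun α => ?_
    have h := Submodule.finrank_mono (LinearMap.range_comp_le_range (s α) (r α))
    exact div_le_div_of_nonneg_right (Nat.cast_le.mpr h) (hpos α).le
  · refine le_of_tendsto_of_tendsto' (hN (r * s)) (hN s) fun α => ?_
    have h := Submodule.finrank_map_le (r α) (LinearMap.range (s α))
    rw [← LinearMap.range_comp] at h
    exact div_le_div_of_nonneg_right (Nat.cast_le.mpr h) (hpos α).le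
  · refine tendsto_nhds_unique (hN (e + f)) (((hN e).add (hN f)).congr fun α => ?_)
    rw [Pi.add_apply, LinearMap.finrank_range_add_of_isIdempotentElem (congrFun he α)
      (congrFun hf α) (congrFun hef α) (congrFun hfe α), Nat.cast_add, add_div]
  · exact ge_of_tendsto' (hN r) fun α => by positivity
  · exact le_of_tendsto' (hN r) fun α =>
      div_le_one_of_le₀ (Nat.cast_le.mpr (Submodule.finrank_le _)) (hpos α).le
end

section
/- Let I be a set, ω an ultrafilter on I, D a division ring, and (A_α)_{α∈I} a family of nonzero finite-dimensional D-vector spaces. Let E = ∏_{α∈I} End_D(A_α) be the product ring, and let M = { r = (r_α) ∈ E : the function α ↦ rank(r_α)/dim(A_α) converges to 0 along ω }. Then M is a two-sided ideal of E, M ≠ E, and M is a maximal two-sided ideal: every two-sided ideal of E strictly containing M equals E (equivalently, the quotient ring E/M is a simple ring). -/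
open Filter

section EndomorphismRank

variable {D V : Type*} [DivisionRing D] [AddCommGroup V] [Module D V]

theorem finrank_range_zero : Module.finrank D (LinearMap.range (0 : Module.End D V)) = 0 := by
  rw [show LinearMap.range (0 : Module.End D V) = ⊥ from LinearMap.range_zero, finrank_bot]

theorem finrank_range_neg (f : Module.End D V) :
    Module.finrank D (LinearMap.range (-f)) = Module.finrank D (LinearMap.range f) := by
  rw [show LinearMap.range (-f) = LinearMap.range f from LinearMap.range_neg f]

variable [FiniteDimensional D V]

theorem finrank_range_add_le (f g : Module.End D V) :
    Module.finrank D (LinearMap.range (f + g)) ≤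
      Module.finrank D (LinearMap.range f) + Module.finrank D (LinearMap.range g) :=
  (Submodule.finrank_mono (LinearMap.range_add_le f g)).trans
    (Submodule.finrank_add_le_finrank_add_finrank _ _)

theorem finrank_range_mul_le_left (f g : Module.End D V) :
    Module.finrank D (LinearMap.range (f * g)) ≤ Module.finrank D (LinearMap.range f) :=
  Submodule.finrank_mono (LinearMap.range_comp_le_range g f)

theorem finrank_range_mul_le_right (f g : Module.End D V) :
    Module.finrank D (LinearMap.range (f * g)) ≤ Module.finrank D (LinearMap.range g) := by
  rw [Module.End.mul_eq_comp, LinearMap.range_comp]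
  exact Submodule.finrank_map_le f _

/-- If `k` copies of the range of `f` are large enough to contain the whole space, then the
identity is a sum of `k` two-sided multiples of `f`. -/
theorem exists_sum_mul_mul_eq_one (f : Module.End D V) (k : ℕ)
    (hk : Module.finrank D V ≤ k * Module.finrank D (LinearMap.range f)) :
    ∃ b c : Fin k → Module.End D V, ∑ j, b j * f * c j = 1 := by
  have hle : Module.finrank D V ≤ Module.finrank D (Fin k → LinearMap.range f) := by
    rwa [Module.finrank_pi_fintype, Finset.sum_const, Finset.card_univ, Fintype.card_fin,
      smul_eq_mul]
  obtain ⟨i, hi⟩ := finrank_le_iff_exists_linearMap.1 hle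
  obtain ⟨p, hp⟩ := i.exists_leftInverse_of_injective (LinearMap.ker_eq_bot.2 hi)
  obtain ⟨s, hs⟩ := f.rangeRestrict.exists_rightInverse_of_surjective f.range_rangeRestrict
  obtain ⟨q, hq⟩ := (LinearMap.range f).subtype.exists_leftInverse_of_injective
    (Submodule.ker_subtype _)
  refine ⟨fun j => p ∘ₗ LinearMap.single D _ j ∘ₗ q, fun j => s ∘ₗ LinearMap.proj j ∘ₗ i, ?_⟩
  have hqfs (x : LinearMap.range f) : q (f (s x)) = x := by
    have hfs : f (s x) = x := congrArg Subtype.val (LinearMap.congr_fun hs x)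
    rw [hfs]
    exact LinearMap.congr_fun hq x
  ext v
  have hv : p (i v) = v := LinearMap.congr_fun hp v
  simp only [LinearMap.sum_apply, Module.End.mul_apply, LinearMap.comp_apply, LinearMap.proj_apply,
    hqfs, LinearMap.single_apply, ← map_sum, Finset.univ_sum_single, hv, Module.End.one_apply]

end EndomorphismRank

/-- The two-sided ideal of the families of endomorphisms whose normalized ranks tend to `0` along
a filter. -/
def rankNullIdeal {I : Type*} (l : Filter I) {D : Type*} [DivisionRing D]
    (A : I → Type*) [∀ α, AddCommGroup (A α)] [∀ α, Module D (A α)]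
    [∀ α, FiniteDimensional D (A α)] : TwoSidedIdeal (∀ α, Module.End D (A α)) :=
  .mk' {r | Tendsto
      (fun α => (Module.finrank D (LinearMap.range (r α)) : ℝ) / Module.finrank D (A α)) l (nhds 0)}
    (by simp [finrank_range_zero, tendsto_const_nhds])
    (fun {x y} hx hy => by
      have h := Tendsto.add hx hy
      rw [add_zero] at h
      refine squeeze_zero (fun α => by positivity) (fun α => ?_) h
      rw [← add_div]
      gcongr
      exact_mod_cast finrank_range_add_le (x α) (y α))
    (fun {x} hx => by simpa [finrank_range_neg] using hx)
    (fun {x y} hy => squeeze_zero (fun α => by positivity)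
      (fun α => by
        gcongr
        exact finrank_range_mul_le_right (x α) (y α)) hy)
    (fun {x y} hx => squeeze_zero (fun α => by positivity)
      (fun α => by
        gcongr
        exact finrank_range_mul_le_left (x α) (y α)) hx)

theorem mem_rankNullIdeal {I : Type*} {l : Filter I} {D : Type*} [DivisionRing D]
    {A : I → Type*} [∀ α, AddCommGroup (A α)] [∀ α, Module D (A α)]
    [∀ α, FiniteDimensional D (A α)] {r : ∀ α, Module.End D (A α)} :
    r ∈ rankNullIdeal l A ↔ Tendsto
      (fun α => (Module.finrank D (LinearMap.range (r α)) : ℝ) / Module.finrank D (A α))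
      l (nhds 0) :=
  TwoSidedIdeal.mem_mk' ..

theorem mem_rankNullIdeal_of_eventually_eq_zero {I : Type*} {l : Filter I} {D : Type*}
    [DivisionRing D] {A : I → Type*} [∀ α, AddCommGroup (A α)] [∀ α, Module D (A α)]
    [∀ α, FiniteDimensional D (A α)] {r : ∀ α, Module.End D (A α)} (hr : ∀ᶠ α in l, r α = 0) :
    r ∈ rankNullIdeal l A :=
  mem_rankNullIdeal.2 <| tendsto_const_nhds.congr' <| hr.mono fun α hα => by
    beta_reduce
    rw [hα, finrank_range_zero, Nat.cast_zero, zero_div]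

/-- If the normalized ranks of `r` do not tend to `0` along an ultrafilter, then they are
eventually bounded below. -/
theorem exists_eventually_finrank_le_mul {I : Type*} (ω : Ultrafilter I) {D : Type*}
    [DivisionRing D] {A : I → Type*} [∀ α, AddCommGroup (A α)] [∀ α, Module D (A α)]
    [∀ α, FiniteDimensional D (A α)] (hA : ∀ α, Nontrivial (A α))
    {r : ∀ α, Module.End D (A α)} (hr : r ∉ rankNullIdeal (ω : Filter I) A) :
    ∃ k : ℕ, ∀ᶠ α in (ω : Filter I),
      Module.finrank D (A α) ≤ k * Module.finrank D (LinearMap.range (r α)) := by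
  rw [mem_rankNullIdeal, Metric.tendsto_nhds] at hr
  push Not at hr
  obtain ⟨ε, hε, hfreq⟩ := hr
  obtain ⟨k, hk⟩ := exists_nat_gt ε⁻¹
  refine ⟨k, hfreq.mono fun α hα => ?_⟩
  have hd : (0 : ℝ) < Module.finrank D (A α) := by
    have := hA α
    exact_mod_cast Module.finrank_pos (R := D) (M := A α)
  rw [Real.dist_0_eq_abs, abs_of_nonneg (by positivity), le_div_iff₀ hd] at hα
  have hkε : 1 ≤ k * ε := by
    rw [inv_lt_iff_one_lt_mul₀ hε] at hk
    exact hk.le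
  have h : (Module.finrank D (A α) : ℝ) ≤ k * Module.finrank D (LinearMap.range (r α)) :=
    calc (Module.finrank D (A α) : ℝ) ≤ (k * ε) * Module.finrank D (A α) :=
          le_mul_of_one_le_left hd.le hkε
      _ = k * (ε * Module.finrank D (A α)) := mul_assoc _ _ _
      _ ≤ _ := by gcongr
  exact_mod_cast h

/-- The set of elements of the product of the endomorphism rings whose normalized ranks
tend to `0` along an ultrafilter is a maximal two-sided ideal. -/
theorem kernel_of_rank_ultralimit_isMaximal_twoSidedIdeal
    {I : Type*} (ω : Ultrafilter I) {D : Type*} [DivisionRing D]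
    (A : I → Type*) [∀ α, AddCommGroup (A α)] [∀ α, Module D (A α)]
    [∀ α, FiniteDimensional D (A α)] (hA : ∀ α, Nontrivial (A α)) :
    ∃ M : TwoSidedIdeal (∀ α, Module.End D (A α)),
      (∀ r : ∀ α, Module.End D (A α), r ∈ M ↔
        Tendsto
          (fun α => (Module.finrank D (LinearMap.range (r α)) : ℝ) / Module.finrank D (A α))
          (ω : Filter I) (nhds 0)) ∧
      M ≠ ⊤ ∧
      (∀ J : TwoSidedIdeal (∀ α, Module.End D (A α)), M < J → J = ⊤) := by
  classical
  refine ⟨rankNullIdeal ω A, fun r => mem_rankNullIdeal, fun htop => ?_, fun J hJ => ?_⟩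
  · have hmem : (1 : ∀ α, Module.End D (A α)) ∈ rankNullIdeal (ω : Filter I) A :=
      (TwoSidedIdeal.one_mem_iff _).2 htop
    have h := mem_rankNullIdeal.1 hmem
    have hone : (fun α => (Module.finrank D (LinearMap.range
        ((1 : ∀ α, Module.End D (A α)) α)) : ℝ) / Module.finrank D (A α)) = fun _ => 1 := by
      funext α
      have := hA α
      have hd : (Module.finrank D (A α) : ℝ) ≠ 0 := by
        exact_mod_cast (Module.finrank_pos (R := D) (M := A α)).ne'
      rw [Pi.one_apply, Module.End.one_eq_id, LinearMap.range_id, finrank_top, div_self hd]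
    rw [hone] at h
    exact one_ne_zero (tendsto_nhds_unique tendsto_const_nhds h)
  · obtain ⟨r, hrJ, hr⟩ := SetLike.exists_of_lt hJ
    obtain ⟨k, hk⟩ := exists_eventually_finrank_le_mul ω hA hr
    have hex (α : I) : ∃ b c : Fin k → Module.End D (A α),
        Module.finrank D (A α) ≤ k * Module.finrank D (LinearMap.range (r α)) →
          ∑ j, b j * r α * c j = 1 := by
      by_cases h : Module.finrank D (A α) ≤ k * Module.finrank D (LinearMap.range (r α))
      · obtain ⟨b, c, hbc⟩ := exists_sum_mul_mul_eq_one (r α) k h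
        exact ⟨b, c, fun _ => hbc⟩
      · exact ⟨0, 0, fun h' => absurd h' h⟩
    choose b c hbc using hex
    set e : ∀ α, Module.End D (A α) := ∑ j, (fun α => b α j) * r * (fun α => c α j) with he
    have heJ : e ∈ J := sum_mem fun j _ => J.mul_mem_right _ _ (J.mul_mem_left _ _ hrJ)
    have hsub : 1 - e ∈ J := hJ.le <| mem_rankNullIdeal_of_eventually_eq_zero <|
      hk.mono fun α hα => by
        simp [he, Finset.sum_apply, hbc α hα]
    rw [← TwoSidedIdeal.one_mem_iff]
    simpa using J.add_mem hsub heJ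
end

section
/- Let G be a countable group and F a finite field. Equip the space F^G of functions from G to F with the product topology, where F carries the discrete topology, and for each g in G let R_g : F^G → F^G be the translation map (R_g x)(h) = x(h·g). Suppose that every continuous map f : F^G → F^G satisfying f ∘ R_g = R_g ∘ f for all g in G is surjective whenever it is injective. Then the group algebra F(G) is directly finite: for all a, b in F(G), if a·b = 1 then b·a = 1. -/
/-- The left translation representation of `G` on functions `G → F`. -/
def leftTranslation (F G : Type*) [CommSemiring F] [Group G] : G →* Module.End F (G → F) where
  toFun g := LinearMap.funLeft F F (g⁻¹ * ·)
  map_one' := by ext; simp [LinearMap.funLeft_apply]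
  map_mul' g k := by
    refine LinearMap.ext fun x => funext fun h => ?_
    simp [LinearMap.funLeft_apply, mul_assoc]

namespace MonoidAlgebra

variable {F G : Type*} [CommSemiring F] [Group G]

/-- The action of the group algebra `F(G)` on `G → F` by convolution on the left. -/
noncomputable def convolution :
    MonoidAlgebra F G →ₐ[F] Module.End F (G → F) :=
  MonoidAlgebra.lift F (Module.End F (G → F)) G (leftTranslation F G)

theorem convolution_apply (a : MonoidAlgebra F G) (x : G → F) (h : G) :
    convolution a x h = a.coeff.sum fun g r => r * x (g⁻¹ * h) := by
  simp [convolution, MonoidAlgebra.lift_apply, Finsupp.sum, leftTranslation,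
    LinearMap.funLeft_apply]

theorem convolution_comp_mul_right (a : MonoidAlgebra F G) (g : G) (x : G → F) :
    convolution a (fun h => x (h * g)) = fun h => convolution a x (h * g) := by
  ext h
  simp [convolution_apply, mul_assoc]

theorem continuous_convolution [TopologicalSpace F] [ContinuousAdd F] [ContinuousMul F]
    (a : MonoidAlgebra F G) : Continuous (convolution a : (G → F) → G → F) := by
  refine continuous_pi fun h => ?_
  simp only [convolution_apply, Finsupp.sum]
  fun_prop

theorem convolution_injective :
    Function.Injective (convolution : MonoidAlgebra F G → Module.End F (G → F)) := by
  classical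
  have key (a : MonoidAlgebra F G) (g : G) :
      convolution a (Pi.single g⁻¹ 1) 1 = a.coeff g := by
    simp [convolution_apply, Finsupp.sum, Pi.single_apply, eq_comm]
  intro a b hab
  ext g
  rw [← key, hab, key]

end MonoidAlgebra


/-- If every continuous self-map of `F^G` commuting with the right translation action of a
countable group `G` (where `F` is a finite field with the discrete topology and `F^G`
carries the product topology) is surjective whenever it is injective, then the group
algebra `F(G)` is directly finite. -/
theorem monoidAlgebra_directFinite_of_surjunctive
    {G : Type*} [Group G] [Countable G]
    (F : Type*) [Field F] [Finite F] [TopologicalSpace F] [DiscreteTopology F]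
    (h : ∀ f : (G → F) → (G → F), Continuous f →
      (∀ (g : G) (x : G → F), f (fun h' => x (h' * g)) = fun h' => f x (h' * g)) →
      Function.Injective f → Function.Surjective f) :
    ∀ a b : MonoidAlgebra F G, a * b = 1 → b * a = 1 := by
  intro a b hab
  have left_inv : MonoidAlgebra.convolution a * MonoidAlgebra.convolution b = 1 := by
    rw [← map_mul, hab, map_one]
  have inj : Function.LeftInverse (MonoidAlgebra.convolution a)
      (MonoidAlgebra.convolution b : (G → F) → G → F) :=
    fun x => LinearMap.congr_fun left_inv x
  have surj := h (MonoidAlgebra.convolution b) (MonoidAlgebra.continuous_convolution b)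
    (MonoidAlgebra.convolution_comp_mul_right b) inj.injective
  apply MonoidAlgebra.convolution_injective
  rw [map_mul, map_one]
  exact LinearMap.ext (inj.rightInverse_of_surjective surj)
end

section
/- Every group satisfying the Følner condition is sofic. That is, if G is a group such that for every finite subset F of G and every real ε > 0 there exists a nonempty finite subset V of G whose F-boundary { v ∈ V : there exists f ∈ F with f·v ∉ V } has at most ε|V| elements, then G is sofic. -/
/-- Left translation by `g` on a finite set `V`, extended by the identity at the points that
leave `V`, and read on `Fin V.card`. -/
noncomputable def truncatedTranslation {G : Type*} [Group G] (V : Finset G) (g : G)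
    (i : Fin V.card) : Fin V.card :=
  open Classical in
  if hg : g * (V.equivFin.symm i : G) ∈ V then V.equivFin ⟨_, hg⟩ else i

theorem truncatedTranslation_of_mem {G : Type*} [Group G] {V : Finset G} {g : G}
    {i : Fin V.card} (hg : g * (V.equivFin.symm i : G) ∈ V) :
    (V.equivFin.symm (truncatedTranslation V g i) : G) = g * V.equivFin.symm i := by
  simp [truncatedTranslation, hg]

theorem truncatedTranslation_one {G : Type*} [Group G] (V : Finset G) (i : Fin V.card) :
    truncatedTranslation V 1 i = i := by
  simp [truncatedTranslation]

theorem truncatedTranslation_mul {G : Type*} [Group G] {V : Finset G} {e f : G}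
    {i : Fin V.card} (hf : f * (V.equivFin.symm i : G) ∈ V)
    (hef : e * f * (V.equivFin.symm i : G) ∈ V) :
    truncatedTranslation V (e * f) i = truncatedTranslation V e (truncatedTranslation V f i) := by
  apply V.equivFin.symm.injective
  apply Subtype.ext
  have hφ := truncatedTranslation_of_mem hf
  rw [truncatedTranslation_of_mem hef, truncatedTranslation_of_mem, hφ, mul_assoc]
  rwa [hφ, ← mul_assoc]

theorem truncatedTranslation_ne_self {G : Type*} [Group G] {V : Finset G} {g : G}
    {i : Fin V.card} (hg : g * (V.equivFin.symm i : G) ∈ V) (hg1 : g ≠ 1) :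
    truncatedTranslation V g i ≠ i := by
  intro hi
  have hφ := truncatedTranslation_of_mem hg
  rw [hi] at hφ
  exact hg1 (right_eq_mul.mp hφ)

/-- A set of indices of points in the `F`-boundary of `V` is no larger than that boundary. -/
theorem card_le_card_boundary {G : Type*} [Group G] {V F : Finset G} {S : Set (Fin V.card)}
    (hS : ∀ i ∈ S, ∃ f ∈ F, f * (V.equivFin.symm i : G) ∉ V) :
    Nat.card S ≤ Nat.card {v : G | v ∈ V ∧ ∃ f ∈ F, f * v ∉ V} := by
  have : Finite {v : G | v ∈ V ∧ ∃ f ∈ F, f * v ∉ V} :=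
    (V.finite_toSet.subset fun _ hv => hv.1).to_subtype
  refine Nat.card_le_card_of_injective
    (fun i => ⟨V.equivFin.symm i, (V.equivFin.symm i).2, hS i i.2⟩) fun i j hij => ?_
  exact Subtype.ext (V.equivFin.symm.injective (Subtype.ext (Subtype.mk.inj hij)))

/-- Every group satisfying the Følner condition (in particular, every amenable group)
is sofic. -/
theorem isSofic_of_folner
    {G : Type*} [Group G]
    (h : ∀ F : Finset G, ∀ ε : ℝ, 0 < ε → ∃ V : Finset G, V.Nonempty ∧
      (Nat.card {v : G | v ∈ V ∧ ∃ f ∈ F, f * v ∉ V} : ℝ) ≤ ε * V.card) :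
    IsSofic G := by
  classical
  intro ε hε _ F
  obtain ⟨V, hV, hB⟩ := h (F ∪ Finset.image₂ (· * ·) F F) (ε / 2) (half_pos hε)
  have hpos : (0 : ℝ) < V.card := by exact_mod_cast hV.card_pos
  have hlt : ε / 2 * V.card < ε * V.card := by gcongr; exact half_lt_self hε
  have hle {S : Set (Fin V.card)}
      (hS : ∀ i ∈ S, ∃ f ∈ F ∪ Finset.image₂ (· * ·) F F, f * (V.equivFin.symm i : G) ∉ V) :
      (Nat.card S : ℝ) < ε * V.card :=
    ((Nat.cast_le.mpr (card_le_card_boundary hS)).trans hB).trans_lt hlt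
  refine ⟨Fin V.card, inferInstance, ⟨⟨0, hV.card_pos⟩⟩, truncatedTranslation V, ?_, ?_, ?_⟩
  · intro e he f hf
    rw [Nat.card_fin]
    refine (hle fun i hi => ?_).le
    by_contra! hmem
    exact hi (truncatedTranslation_mul (hmem f (Finset.mem_union_left _ hf))
      (hmem (e * f) (Finset.mem_union_right _ (Finset.mem_image₂_of_mem he hf))))
  · rw [Nat.card_fin]
    exact (hle fun i hi => absurd (truncatedTranslation_one V i) hi).le
  · intro e he he1
    rw [Nat.card_fin]
    refine hle fun i hi => ⟨e, Finset.mem_union_left _ he, fun hmem => ?_⟩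
    exact truncatedTranslation_ne_self hmem he1 hi
end

section
/- The direct product of two sofic groups is sofic: if G and H are sofic groups, then the product group G × H is sofic. -/
/-- If two properties each hold on at most half of an `ε` fraction of their finite types, then
their disjunction holds on at most an `ε` fraction of the product. -/
theorem natCard_or_prod_le {V W : Type*} [Finite V] [Finite W] {p : V → Prop} {q : W → Prop}
    {ε : ℝ} (hp : (Nat.card {v | p v} : ℝ) ≤ ε / 2 * Nat.card V)
    (hq : (Nat.card {w | q w} : ℝ) ≤ ε / 2 * Nat.card W) {s : Set (V × W)}
    (hs : ∀ x ∈ s, p x.1 ∨ q x.2) :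
    (Nat.card s : ℝ) ≤ ε * Nat.card (V × W) := by
  have hsub : s ⊆ {v | p v} ×ˢ Set.univ ∪ Set.univ ×ˢ {w | q w} := fun x hx => by
    simpa using hs x hx
  have hcard : s.ncard ≤ Nat.card {v | p v} * Nat.card W + Nat.card V * Nat.card {w | q w} := by
    refine (Set.ncard_le_ncard hsub (Set.toFinite _)).trans ((Set.ncard_union_le _ _).trans ?_)
    rw [Set.ncard_prod, Set.ncard_prod, Set.ncard_univ, Set.ncard_univ]
    rfl
  rw [Nat.card_coe_set_eq, Nat.card_prod]
  have hcard' : (s.ncard : ℝ) ≤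
      Nat.card {v | p v} * Nat.card W + Nat.card V * Nat.card {w | q w} := by
    exact_mod_cast hcard
  have h₁ := mul_le_mul_of_nonneg_right hp (Nat.cast_nonneg (α := ℝ) (Nat.card W))
  have h₂ := mul_le_mul_of_nonneg_left hq (Nat.cast_nonneg (α := ℝ) (Nat.card V))
  push_cast
  linarith

/-- A subset of a finite product whose first coordinates lie in a set of density less than `ε`
has density less than `ε`. -/
theorem natCard_lt_of_fst {V W : Type*} [Finite V] [Finite W] [Nonempty W] {p : V → Prop}
    {ε : ℝ} (hp : (Nat.card {v | p v} : ℝ) < ε * Nat.card V) {s : Set (V × W)}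
    (hs : ∀ x ∈ s, p x.1) :
    (Nat.card s : ℝ) < ε * Nat.card (V × W) := by
  have hsub : s ⊆ {v | p v} ×ˢ Set.univ := fun x hx => by simpa using hs x hx
  have hcard : s.ncard ≤ Nat.card {v | p v} * Nat.card W := by
    refine (Set.ncard_le_ncard hsub (Set.toFinite _)).trans ?_
    rw [Set.ncard_prod, Set.ncard_univ]
    rfl
  rw [Nat.card_coe_set_eq, Nat.card_prod]
  have hcard' : (s.ncard : ℝ) ≤ Nat.card {v | p v} * Nat.card W := by exact_mod_cast hcard
  have h := mul_lt_mul_of_pos_right hp (Nat.cast_pos (α := ℝ).2 (Nat.card_pos (α := W)))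
  push_cast
  linarith

/-- A subset of a finite product whose second coordinates lie in a set of density less than `ε`
has density less than `ε`. -/
theorem natCard_lt_of_snd {V W : Type*} [Finite V] [Finite W] [Nonempty V] {q : W → Prop}
    {ε : ℝ} (hq : (Nat.card {w | q w} : ℝ) < ε * Nat.card W) {s : Set (V × W)}
    (hs : ∀ x ∈ s, q x.2) :
    (Nat.card s : ℝ) < ε * Nat.card (V × W) := by
  have h := natCard_lt_of_fst (W := V) hq (s := Prod.swap ⁻¹' s) fun x hx => hs x.swap hx
  rwa [Nat.card_preimage_of_injective Prod.swap_injective (by simp [Prod.swap_surjective.range_eq]),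
    Nat.card_congr (Equiv.prodComm W V)] at h

/-- The direct product of two sofic groups is sofic. -/
theorem isSofic_prod
    {G : Type*} [Group G] {H : Type*} [Group H]
    (hG : IsSofic G) (hH : IsSofic H) :
    IsSofic (G × H) := by
  classical
  intro ε hε hε1 F
  obtain ⟨V, _, _, φ, hφmul, hφone, hφfree⟩ :=
    hG (ε / 2) (by linarith) (by linarith) (F.image Prod.fst)
  obtain ⟨W, _, _, ψ, hψmul, hψone, hψfree⟩ :=
    hH (ε / 2) (by linarith) (by linarith) (F.image Prod.snd)
  refine ⟨V × W, inferInstance, inferInstance, fun g x => (φ g.1 x.1, ψ g.2 x.2), ?_, ?_, ?_⟩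
  · intro e he f hf
    refine natCard_or_prod_le
      (hφmul e.1 (Finset.mem_image_of_mem _ he) f.1 (Finset.mem_image_of_mem _ hf))
      (hψmul e.2 (Finset.mem_image_of_mem _ he) f.2 (Finset.mem_image_of_mem _ hf)) ?_
    intro x hx
    simpa [Prod.ext_iff, imp_iff_not_or] using hx
  · refine natCard_or_prod_le hφone hψone fun x hx => ?_
    simpa [Prod.ext_iff, imp_iff_not_or] using hx
  · intro e he hne
    have hle : ∀ n : ℕ, ε / 2 * (n : ℝ) ≤ ε * n := fun n => by gcongr; linarith
    by_cases h1 : e.1 = 1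
    · have h2 : e.2 ≠ 1 := fun h2 => hne (Prod.ext h1 h2)
      exact natCard_lt_of_snd ((hψfree e.2 (Finset.mem_image_of_mem _ he) h2).trans_le (hle _))
        fun x hx => congrArg Prod.snd hx
    · exact natCard_lt_of_fst ((hφfree e.1 (Finset.mem_image_of_mem _ he) h1).trans_le (hle _))
        fun x hx => congrArg Prod.fst hx
end

section
/- The free product of two sofic groups is sofic: if G and H are sofic groups, then the free product (coproduct) G ∗ H is sofic. -/
open Filter Topology

namespace Sofic

section Negligible

variable {ι : Type*} {l : Filter ι} {V W : ι → Type}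

/-- A family of subsets of finite sets whose densities tend to zero. -/
def Negligible (l : Filter ι) (S : ∀ i, Set (V i)) : Prop :=
  Tendsto (fun i => ((S i).ncard : ℝ) / Nat.card (V i)) l (𝓝 0)

theorem negligible_empty : Negligible l (fun i => (∅ : Set (V i))) := by
  simpa [Negligible] using tendsto_const_nhds

theorem Negligible.of_ncard_le {S : ∀ i, Set (V i)} {T : ∀ i, Set (V i)}
    (hT : Negligible l T) (h : ∀ i, (S i).ncard ≤ (T i).ncard) : Negligible l S :=
  squeeze_zero (fun _ => by positivity)
    (fun i => div_le_div_of_nonneg_right (Nat.cast_le.2 (h i)) (Nat.cast_nonneg _)) hT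

theorem Negligible.mono [∀ i, Finite (V i)] {S T : ∀ i, Set (V i)}
    (hT : Negligible l T) (h : ∀ i, S i ⊆ T i) : Negligible l S :=
  hT.of_ncard_le fun i => Set.ncard_le_ncard (h i)

theorem Negligible.of_ncard_le_add {R S T : ∀ i, Set (V i)}
    (hS : Negligible l S) (hT : Negligible l T)
    (h : ∀ i, (R i).ncard ≤ (S i).ncard + (T i).ncard) : Negligible l R := by
  refine squeeze_zero (fun _ => by positivity) (fun i => ?_) (by simpa using Tendsto.add hS hT)
  rw [← add_div]
  gcongr
  exact_mod_cast h i

theorem Negligible.union {S T : ∀ i, Set (V i)}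
    (hS : Negligible l S) (hT : Negligible l T) : Negligible l (fun i => S i ∪ T i) :=
  hS.of_ncard_le_add hT fun _ => Set.ncard_union_le _ _

theorem Negligible.comp {κ : Type*} {m : Filter κ} {S : ∀ i, Set (V i)}
    (hS : Negligible l S) {p : κ → ι} (hp : Tendsto p m l) :
    Negligible m (fun k => S (p k)) :=
  Tendsto.comp hS hp

theorem Negligible.preimage_fst [∀ i, Finite (W i)] [∀ i, Nonempty (W i)]
    {S : ∀ i, Set (V i)} (hS : Negligible l S) :
    Negligible l (fun i => (Prod.fst ⁻¹' S i : Set (V i × W i))) := by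
  refine Tendsto.congr (fun i => ?_) hS
  have hW : (Nat.card (W i) : ℝ) ≠ 0 := Nat.cast_ne_zero.2 Nat.card_pos.ne'
  dsimp only
  rw [← Set.prod_univ, Set.ncard_prod, Set.ncard_univ, Nat.card_prod, Nat.cast_mul, Nat.cast_mul,
    mul_div_mul_right _ _ hW]

theorem Negligible.preimage_snd [∀ i, Finite (W i)] [∀ i, Nonempty (W i)]
    {S : ∀ i, Set (V i)} (hS : Negligible l S) :
    Negligible l (fun i => (Prod.snd ⁻¹' S i : Set (W i × V i))) := by
  refine Tendsto.congr (fun i => ?_) hS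
  have hW : (Nat.card (W i) : ℝ) ≠ 0 := Nat.cast_ne_zero.2 Nat.card_pos.ne'
  dsimp only
  rw [← Set.univ_prod, Set.ncard_prod, Set.ncard_univ, Nat.card_prod, Nat.cast_mul, Nat.cast_mul,
    mul_div_mul_left _ _ hW]

/-- Preimages of negligible families are negligible. -/
def IsNonsingular (l : Filter ι) (f : ∀ i, V i → V i) : Prop :=
  ∀ S : ∀ i, Set (V i), Negligible l S → Negligible l (fun i => f i ⁻¹' S i)

end Negligible

section AlmostAction

variable {ι : Type*} {l : Filter ι} {V : ι → Type} {G : Type*} [Group G]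

/-- A family of maps `G → Map(V i)` which is asymptotically an action. -/
structure IsAlmostAction (l : Filter ι) (ρ : ∀ i, G → V i → V i) : Prop where
  map_mul : ∀ e f, Negligible l (fun i => {v | ρ i (e * f) v ≠ ρ i e (ρ i f v)})
  map_one : Negligible l (fun i => {v | ρ i 1 v ≠ v})

theorem IsAlmostAction.isNonsingular [∀ i, Finite (V i)] {ρ : ∀ i, G → V i → V i}
    (h : IsAlmostAction l ρ) (e : G) : IsNonsingular l (fun i => ρ i e) := by
  intro S hS
  have hbad : Negligible l (fun i => {v | ρ i e⁻¹ (ρ i e v) ≠ v}) := by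
    refine ((h.map_mul e⁻¹ e).union h.map_one).mono fun i v hv => ?_
    by_contra hc
    simp only [inv_mul_cancel, Set.mem_union, Set.mem_ofPred_eq, not_or, not_not] at hc hv
    exact hv (hc.1.symm.trans hc.2)
  refine hS.of_ncard_le_add hbad fun i => ?_
  rw [← Set.ncard_inter_add_ncard_sdiff_eq_ncard (ρ i e ⁻¹' S i) {v | ρ i e⁻¹ (ρ i e v) = v}]
  refine add_le_add (Set.ncard_le_ncard_of_injOn (ρ i e) (fun v hv => hv.1) ?_)
    (Set.ncard_le_ncard fun v hv => hv.2)
  intro v hv w hw hvw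
  rw [← hv.2, ← hw.2, hvw]

theorem exists_almostAction_of_isSofic (hG : IsSofic G) :
    ∃ (V : ℕ × Finset G → Type) (_ : ∀ i, Finite (V i)) (_ : ∀ i, Nonempty (V i))
      (ρ : ∀ i, G → V i → V i), IsAlmostAction atTop ρ ∧
        ∀ e, e ≠ 1 → Negligible atTop (fun i => {v | ρ i e v = v}) := by
  classical
  have hε (i : ℕ × Finset G) : (0 : ℝ) < 1 / ((i.1 : ℝ) + 2) := by positivity
  have hε' (i : ℕ × Finset G) : 1 / ((i.1 : ℝ) + 2) < 1 := by
    rw [div_lt_one (by positivity)]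
    linarith [(Nat.cast_nonneg i.1 : (0 : ℝ) ≤ i.1)]
  choose V hfin hne ρ hmul hone hfree using fun i : ℕ × Finset G => hG _ (hε i) (hε' i) i.2
  have hlim : Tendsto (fun i : ℕ × Finset G => 1 / ((i.1 : ℝ) + 2)) atTop (𝓝 0) := by
    have h1 : Tendsto (fun n : ℕ => 1 / ((n : ℝ) + 2)) atTop (𝓝 0) :=
      tendsto_const_nhds.div_atTop (tendsto_atTop_add_const_right _ _ tendsto_natCast_atTop_atTop)
    rw [← prod_atTop_atTop_eq]
    exact h1.comp tendsto_fst
  have hmem (e : G) : ∀ᶠ i : ℕ × Finset G in atTop, e ∈ i.2 := by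
    filter_upwards [eventually_ge_atTop ((0, {e}) : ℕ × Finset G)] with i hi
    exact hi.2 (Finset.mem_singleton_self e)
  have key (S : ∀ i, Set (V i))
      (hS : ∀ᶠ i in atTop, (Nat.card (S i) : ℝ) ≤ 1 / ((i.1 : ℝ) + 2) * Nat.card (V i)) :
      Negligible atTop S := by
    refine squeeze_zero' (Eventually.of_forall fun _ => by positivity) ?_ hlim
    filter_upwards [hS] with i hi
    have := hne i
    rw [div_le_iff₀ (Nat.cast_pos.2 Nat.card_pos), ← Nat.card_coe_set_eq]
    exact hi
  refine ⟨V, fun i => inferInstance, hne, ρ, ⟨fun e f => key _ ?_, key _ ?_⟩, fun e he => key _ ?_⟩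
  · filter_upwards [hmem e, hmem f] with i h1 h2
    exact hmul i e h1 f h2
  · exact Eventually.of_forall hone
  · filter_upwards [hmem e] with i h1
    exact (hfree i e h1 he).le

theorem isSofic_of_almostAction [l.NeBot] [∀ i, Finite (V i)] [∀ i, Nonempty (V i)]
    {ρ : ∀ i, G → V i → V i} (h : IsAlmostAction l ρ)
    (hfree : ∀ e, e ≠ 1 → Negligible l (fun i => {v | ρ i e v = v})) : IsSofic G := by
  intro ε hε _ F
  have key {S : ∀ i, Set (V i)} (hS : Negligible l S) :
      ∀ᶠ i in l, (Nat.card (S i) : ℝ) < ε * Nat.card (V i) := by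
    filter_upwards [hS.eventually_lt_const hε] with i hi
    rwa [div_lt_iff₀ (Nat.cast_pos.2 Nat.card_pos), ← Nat.card_coe_set_eq] at hi
  have h1 := (eventually_all_finset F).2 fun e _ =>
    (eventually_all_finset F).2 fun f _ => key (h.map_mul e f)
  have h2 : ∀ᶠ i in l, ∀ e ∈ F, e ≠ 1 →
      (Nat.card {v : V i | ρ i e v = v} : ℝ) < ε * Nat.card (V i) :=
    (eventually_all_finset F).2 fun e _ => by
      by_cases he : e = 1
      · simp [he]
      · filter_upwards [key (hfree e he)] with i hi _ using hi
  obtain ⟨i, hi1, hi2, hi3⟩ := (h1.and ((key h.map_one).and h2)).exists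
  exact ⟨V i, Fintype.ofFinite _, inferInstance, ρ i, fun e he f hf => (hi1 e he f hf).le,
    hi2.le, hi3⟩

end AlmostAction

section Words

variable {ι : Type*} {l : Filter ι} {V : ι → Type}

theorem isNonsingular_foldr {X : Type*} {σ : ∀ i, X → V i → V i}
    (hσ : ∀ x, IsNonsingular l (fun i => σ i x)) (r : List X) :
    IsNonsingular l (fun i v => r.foldr (σ i) v) := by
  induction r with
  | nil => exact fun S hS => hS
  | cons x r ih => exact fun S hS => ih (fun i => σ i x ⁻¹' S i) (hσ x S hS)

variable [∀ i, Finite (V i)] {G H : Type*} [Group G] [Group H] {σ : ∀ i, G ⊕ H → V i → V i}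

theorem isNonsingular_letter (hl : IsAlmostAction l (fun i g => σ i (.inl g)))
    (hr : IsAlmostAction l (fun i h => σ i (.inr h))) (x : G ⊕ H) :
    IsNonsingular l (fun i => σ i x) := by
  cases x with
  | inl g => exact hl.isNonsingular g
  | inr h => exact hr.isNonsingular h

/-- The congruence of words acting in asymptotically the same way. -/
def wordCon (l : Filter ι) (σ : ∀ i, G ⊕ H → V i → V i)
    (hσ : ∀ x, IsNonsingular l (fun i => σ i x)) : Con (FreeMonoid (G ⊕ H)) where
  r u w := Negligible l
    (fun i => {v | u.toList.foldr (σ i) v ≠ w.toList.foldr (σ i) v})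
  iseqv :=
    { refl := fun u => by simpa using negligible_empty
      symm := fun h => by simpa only [ne_comm] using h
      trans := fun h h' => (h.union h').mono fun i v hv => by
        by_contra hc
        simp only [Set.mem_union, Set.mem_ofPred_eq, not_or, not_not] at hc hv
        exact hv (hc.1.trans hc.2) }
  mul' := by
    intro u w u' w' h h'
    refine ((isNonsingular_foldr hσ u'.toList _ h).union h').mono fun i v hv => ?_
    by_contra hc
    simp only [Set.mem_union, Set.mem_ofPred_eq, not_or, not_not, Set.mem_preimage,
      FreeMonoid.toList_mul, List.foldr_append] at hc hv
    exact hv (hc.1.trans (by rw [hc.2]))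

theorem negligible_foldr_ne_of_mk_eq (hl : IsAlmostAction l (fun i g => σ i (.inl g)))
    (hr : IsAlmostAction l (fun i h => σ i (.inr h))) {u w : FreeMonoid (G ⊕ H)}
    (h : Monoid.Coprod.mk u = Monoid.Coprod.mk w) :
    Negligible l (fun i => {v | u.toList.foldr (σ i) v ≠ w.toList.foldr (σ i) v}) :=
  Monoid.Coprod.mk_eq_mk.1 h (wordCon l σ (isNonsingular_letter hl hr))
    ⟨hl.map_mul, hr.map_mul, hl.map_one, hr.map_one⟩

/-- Words acting through chosen representatives give an almost action of the free product. -/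
theorem isAlmostAction_coprod (hl : IsAlmostAction l (fun i g => σ i (.inl g)))
    (hr : IsAlmostAction l (fun i h => σ i (.inr h)))
    {rep : Monoid.Coprod G H → FreeMonoid (G ⊕ H)}
    (hrep : ∀ w, Monoid.Coprod.mk (rep w) = w) :
    IsAlmostAction l (fun i w v => (rep w).toList.foldr (σ i) v) where
  map_mul e f := by
    have := negligible_foldr_ne_of_mk_eq hl hr (u := rep (e * f)) (w := rep e * rep f)
      (by rw [map_mul, hrep, hrep, hrep])
    simpa only [FreeMonoid.toList_mul, List.foldr_append] using this
  map_one := by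
    simpa using negligible_foldr_ne_of_mk_eq hl hr (u := rep 1) (w := 1) (by rw [hrep, map_one])

end Words

section ReducedWords

variable {G H : Type*} [Group G] [Group H]

/-- Words of nontrivial letters alternating between the two groups. -/
def IsReducedWord (r : List (G ⊕ H)) : Prop :=
  r.IsChain (fun x y => x.isLeft ≠ y.isLeft) ∧ ∀ x ∈ r, x ≠ .inl 1 ∧ x ≠ .inr 1

theorem IsReducedWord.of_cons {x : G ⊕ H} {r : List (G ⊕ H)} (h : IsReducedWord (x :: r)) :
    IsReducedWord r :=
  ⟨h.1.tail, fun y hy => h.2 y (List.mem_cons_of_mem _ hy)⟩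

theorem IsReducedWord.replace_head {x y : G ⊕ H} {r : List (G ⊕ H)}
    (h : IsReducedWord (x :: r)) (hxy : y.isLeft = x.isLeft) (hy : y ≠ .inl 1 ∧ y ≠ .inr 1) :
    IsReducedWord (y :: r) := by
  refine ⟨?_, ?_⟩
  · have := h.1
    rw [List.isChain_cons] at this ⊢
    rwa [hxy]
  · intro z hz
    rcases List.mem_cons.1 hz with rfl | hz
    · exact hy
    · exact h.of_cons.2 z hz

theorem exists_isReducedWord_cons (x : G ⊕ H) {r : List (G ⊕ H)} (hr : IsReducedWord r) :
    ∃ r' : List (G ⊕ H), IsReducedWord r' ∧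
      Monoid.Coprod.mk (FreeMonoid.ofList r') =
        Monoid.Coprod.mk (FreeMonoid.of x) * Monoid.Coprod.mk (FreeMonoid.ofList r) := by
  by_cases hx : x ≠ .inl 1 ∧ x ≠ .inr 1
  swap
  · refine ⟨r, hr, ?_⟩
    obtain rfl | rfl : x = .inl 1 ∨ x = .inr 1 := by tauto
    · simp
    · simp
  rcases r with _ | ⟨y, r⟩
  · exact ⟨[x], ⟨List.isChain_singleton _, by simpa using hx⟩, by simp⟩
  by_cases hxy : x.isLeft = y.isLeft
  · rcases x with g | h <;> rcases y with g' | h' <;> simp only [Sum.isLeft, reduceCtorEq] at hxy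
    · by_cases hg : g * g' = 1
      · refine ⟨r, hr.of_cons, ?_⟩
        rw [FreeMonoid.ofList_cons, map_mul, ← mul_assoc, Monoid.Coprod.mk_of_inl,
          Monoid.Coprod.mk_of_inl, ← map_mul, hg, map_one, one_mul]
      · refine ⟨.inl (g * g') :: r, hr.replace_head rfl (by simpa using hg), ?_⟩
        simp [FreeMonoid.ofList_cons, mul_assoc]
    · by_cases hg : h * h' = 1
      · refine ⟨r, hr.of_cons, ?_⟩
        rw [FreeMonoid.ofList_cons, map_mul, ← mul_assoc, Monoid.Coprod.mk_of_inr,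
          Monoid.Coprod.mk_of_inr, ← map_mul, hg, map_one, one_mul]
      · refine ⟨.inr (h * h') :: r, hr.replace_head rfl (by simpa using hg), ?_⟩
        simp [FreeMonoid.ofList_cons, mul_assoc]
  · refine ⟨x :: y :: r, ⟨List.isChain_cons_cons.2 ⟨hxy, hr.1⟩, ?_⟩, by
      simp [FreeMonoid.ofList_cons]⟩
    intro z hz
    rcases List.mem_cons.1 hz with rfl | hz
    · exact hx
    · exact hr.2 z hz

theorem exists_isReducedWord (w : Monoid.Coprod G H) :
    ∃ r : List (G ⊕ H), IsReducedWord r ∧ Monoid.Coprod.mk (FreeMonoid.ofList r) = w := by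
  obtain ⟨u, rfl⟩ := Monoid.Coprod.mk_surjective w
  induction u using FreeMonoid.inductionOn' with
  | one => exact ⟨[], ⟨List.isChain_nil, by simp⟩, by simp⟩
  | of_mul x u ih =>
    obtain ⟨r, hr, hru⟩ := ih
    obtain ⟨r', hr', h⟩ := exists_isReducedWord_cons x hr
    exact ⟨r', hr', by rw [h, hru, map_mul]⟩

end ReducedWords

section FreeGroup

theorem freeGroup_eq_one_of_isReduced {α : Type*} {L : List (α × Bool)}
    (hL : FreeGroup.IsReduced L) (h : FreeGroup.mk L = 1) : L = [] := by
  obtain ⟨M, h1, h2⟩ := FreeGroup.Red.exact.1 (h.trans FreeGroup.one_eq_mk)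
  rw [← hL.red_iff_eq.1 h1, FreeGroup.IsReduced.nil.red_iff_eq.1 h2]

/-- Balls in a free group embed in finite quotients. -/
theorem exists_finite_quotient_freeGroup (α : Type) [Finite α] (n : ℕ) :
    ∃ (K : Type) (_ : Group K) (_ : Finite K) (s : α → K),
      ∀ L : List (α × Bool), L.length ≤ n → FreeGroup.lift s (FreeGroup.mk L) = 1 →
        FreeGroup.mk L = 1 := by
  classical
  let X := {w : FreeGroup α // w.norm ≤ n}
  have hX : Finite X := by
    have : Finite {L : List (α × Bool) // L.length ≤ n} :=
      (List.finite_length_le (α × Bool) n).to_subtype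
    exact Finite.of_injective
      (fun w : X => (⟨w.1.toWord, w.2⟩ : {L : List (α × Bool) // L.length ≤ n}))
      fun w w' h => Subtype.ext (FreeGroup.toWord_injective (Subtype.ext_iff.1 h))
  let e (a : α) : {w : X // (FreeGroup.of a * w.1).norm ≤ n} ≃
      {w : X // ((FreeGroup.of a)⁻¹ * w.1).norm ≤ n} :=
    { toFun := fun w => ⟨⟨FreeGroup.of a * w.1.1, w.2⟩, by simpa using w.1.2⟩
      invFun := fun w => ⟨⟨(FreeGroup.of a)⁻¹ * w.1.1, w.2⟩, by simpa using w.1.2⟩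
      left_inv := fun w => by simp
      right_inv := fun w => by simp }
  let s (a : α) : Equiv.Perm X := (e a).extendSubtype
  have hs (a : α) (w : X) (hw : (FreeGroup.of a * w.1).norm ≤ n) :
      s a w = ⟨FreeGroup.of a * w.1, hw⟩ := (e a).extendSubtype_apply_of_mem w hw
  have hs' (a : α) (w : X) (hw : ((FreeGroup.of a)⁻¹ * w.1).norm ≤ n) :
      (s a)⁻¹ w = ⟨(FreeGroup.of a)⁻¹ * w.1, hw⟩ := by
    rw [Equiv.Perm.inv_eq_iff_eq, hs]
    · simp
    · simpa using w.2
  have key (L : List (α × Bool)) (hL : L.length ≤ n) :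
      FreeGroup.lift s (FreeGroup.mk L) ⟨1, by simp⟩ =
        ⟨FreeGroup.mk L, FreeGroup.norm_mk_le.trans hL⟩ := by
    induction L with
    | nil => simp [← FreeGroup.one_eq_mk]
    | cons x L ih =>
      obtain ⟨a, b⟩ := x
      have hn := FreeGroup.norm_mk_le.trans hL
      have ih := ih ((Nat.le_succ _).trans hL)
      cases b
      · have hmk : FreeGroup.mk ((a, false) :: L) = (FreeGroup.of a)⁻¹ * FreeGroup.mk L := by
          simp [FreeGroup.of, FreeGroup.invRev]
        simp only [hmk, map_mul, map_inv, FreeGroup.lift_apply_of, Equiv.Perm.mul_apply, ih] at hn ⊢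
        exact hs' a _ hn
      · have hmk : FreeGroup.mk ((a, true) :: L) = FreeGroup.of a * FreeGroup.mk L := by
          simp [FreeGroup.of]
        simp only [hmk, map_mul, FreeGroup.lift_apply_of, Equiv.Perm.mul_apply, ih] at hn ⊢
        exact hs a _ hn
  refine ⟨Equiv.Perm X, inferInstance, inferInstance, s, fun L hL h => ?_⟩
  have := key L hL
  rw [h] at this
  exact (Subtype.ext_iff.1 this).symm

end FreeGroup

section Twisted

variable {G H A B K : Type*} [Group K]

/-- The two families of maps on `A × B × K`, the second one twisted by the coboundary of `s`. -/
def twisted (s : A × B → K) (φ : G → A → A) (ψ : H → B → B) : G ⊕ H → A × B × K → A × B × K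
  | .inl g, v => (φ g v.1, v.2)
  | .inr h, v => (v.1, ψ h v.2.1, (s (v.1, ψ h v.2.1))⁻¹ * s (v.1, v.2.1) * v.2.2)

/-- The points whose relevant coordinate is fixed by a letter. -/
def stalled (K : Type*) (φ : G → A → A) (ψ : H → B → B) : G ⊕ H → Set (A × B × K)
  | .inl g => {v | φ g v.1 = v.1}
  | .inr h => {v | ψ h v.2.1 = v.2.1}

/-- The points whose orbit under the successive letters of a word stalls at some time. -/
def stalledWord (s : A × B → K) (φ : G → A → A) (ψ : H → B → B) :
    List (G ⊕ H) → Set (A × B × K)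
  | [] => ∅
  | x :: r => stalledWord s φ ψ r ∪
      (fun v => r.foldr (twisted s φ ψ) v) ⁻¹' stalled K φ ψ x

/-- Along a non-stalling orbit the last coordinate is multiplied by a reduced word in the values
of `s`. -/
theorem exists_isReduced_of_notMem_stalledWord [Group G] [Group H]
    (s : A × B → K) (φ : G → A → A) (ψ : H → B → B)
    {r : List (G ⊕ H)} (hr : IsReducedWord r) {v : A × B × K} (hv : v ∉ stalledWord s φ ψ r) :
    ∃ L : List ((A × B) × Bool), L.length ≤ 2 * r.length ∧ FreeGroup.IsReduced L ∧
      (r.foldr (twisted s φ ψ) v).2.2 = FreeGroup.lift s (FreeGroup.mk L) * v.2.2 ∧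
      (L = [] → r = [] ∨ ∃ g, r = [.inl g]) ∧
      match r with
      | [] => L = []
      | .inl _ :: _ => ∀ y ∈ L.head?,
          y.1 ≠ ((r.foldr (twisted s φ ψ) v).1, (r.foldr (twisted s φ ψ) v).2.1)
      | .inr _ :: _ => L.head? =
          some (((r.foldr (twisted s φ ψ) v).1, (r.foldr (twisted s φ ψ) v).2.1), false) := by
  induction r with
  | nil =>
    exact ⟨[], by simp, FreeGroup.IsReduced.nil, by simp [← FreeGroup.one_eq_mk], by simp, rfl⟩
  | cons x r ih =>
    simp only [stalledWord, Set.mem_union, not_or] at hv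
    obtain ⟨L, hlen, hred, hval, hnil, hhead⟩ := ih hr.of_cons hv.1
    have hmove := hv.2
    rw [Set.mem_preimage] at hmove
    rw [List.foldr_cons]
    generalize r.foldr (twisted s φ ψ) v = p at hval hhead hmove
    obtain ⟨a, b, k⟩ := p
    cases x with
    | inl g =>
      refine ⟨L, by rw [List.length_cons]; lia, hred, hval, fun h => ?_, ?_⟩
      · rcases hnil h with rfl | ⟨g', rfl⟩
        · exact .inr ⟨g, rfl⟩
        · simp [IsReducedWord] at hr
      · simp only [stalled, Set.mem_ofPred_eq] at hmove
        rcases r with _ | ⟨g' | h', r⟩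
        · simp_all
        · simp [IsReducedWord] at hr
        · simp only at hhead
          rw [hhead]
          simp only [Option.mem_some_iff, forall_eq', twisted, ne_eq, Prod.mk.injEq, not_and]
          exact fun h => absurd h.symm hmove
    | inr h =>
      simp only [stalled, Set.mem_ofPred_eq] at hmove
      have hne : ∀ y ∈ L.head?, y.1 ≠ (a, b) := by
        rcases r with _ | ⟨g' | h', r⟩
        · simp_all
        · exact hhead
        · simp [IsReducedWord] at hr
      refine ⟨((a, ψ h b), false) :: ((a, b), true) :: L, ?_, ?_, ?_, by simp, by simp [twisted]⟩
      · simp only [List.length_cons]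
        lia
      · refine List.isChain_cons_cons.2 ⟨fun h => ?_, List.isChain_cons.2 ⟨fun y hy h => ?_, hred⟩⟩
        · exact absurd (Prod.ext_iff.1 h).2 hmove
        · exact absurd h.symm (hne y hy)
      · have hmk : FreeGroup.mk (((a, ψ h b), false) :: ((a, b), true) :: L) =
            (FreeGroup.of (a, ψ h b))⁻¹ * FreeGroup.of (a, b) * FreeGroup.mk L := by
          simp [FreeGroup.of, FreeGroup.invRev]
        simp only at hval
        simp [hmk, twisted, hval, mul_assoc]

theorem foldr_twisted_ne_of_notMem_stalledWord [Group G] [Group H]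
    {s : A × B → K} (φ : G → A → A) (ψ : H → B → B)
    {n : ℕ} (hs : ∀ L : List ((A × B) × Bool), L.length ≤ n →
      FreeGroup.lift s (FreeGroup.mk L) = 1 → FreeGroup.mk L = 1)
    {r : List (G ⊕ H)} (hr : IsReducedWord r) (hne : r ≠ []) (hn : 2 * r.length ≤ n)
    {v : A × B × K} (hv : v ∉ stalledWord s φ ψ r) : r.foldr (twisted s φ ψ) v ≠ v := by
  intro hfix
  obtain ⟨L, hlen, hred, hval, hnil, -⟩ := exists_isReduced_of_notMem_stalledWord s φ ψ hr hv
  rw [hfix, right_eq_mul] at hval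
  have hL := freeGroup_eq_one_of_isReduced hred (hs L (hlen.trans hn) hval)
  rcases hnil hL with h | ⟨g, rfl⟩
  · exact hne h
  · refine hv (Or.inr ?_)
    exact (Prod.ext_iff.1 hfix).1

end Twisted

section Product

variable {ι : Type*} {l : Filter ι} {A B K : ι → Type} [∀ i, Finite (A i)] [∀ i, Finite (B i)]
  [∀ i, Group (K i)] [∀ i, Finite (K i)] {G H : Type*} {φ : ∀ i, G → A i → A i}
  {ψ : ∀ i, H → B i → B i}

theorem isAlmostAction_twisted_inl [∀ i, Nonempty (B i)] [Group G]
    (s : ∀ i, A i × B i → K i) (hφ : IsAlmostAction l φ) :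
    IsAlmostAction l (fun i g => twisted (s i) (φ i) (ψ i) (.inl g)) where
  map_mul e f := ((hφ.map_mul e f).preimage_fst (W := fun i => B i × K i)).mono
    fun _ _ hv h => hv (Prod.ext h rfl)
  map_one := (hφ.map_one.preimage_fst (W := fun i => B i × K i)).mono
    fun _ _ hv h => hv (Prod.ext h rfl)

theorem isAlmostAction_twisted_inr [∀ i, Nonempty (A i)] [Group H]
    (s : ∀ i, A i × B i → K i) (hψ : IsAlmostAction l ψ) :
    IsAlmostAction l (fun i h => twisted (s i) (φ i) (ψ i) (.inr h)) where
  map_mul e f := ((hψ.map_mul e f).preimage_fst (W := K)).preimage_snd (W := A) |>.mono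
    fun i v hv h => hv <| by
      have h : ψ i (e * f) v.2.1 = ψ i e (ψ i f v.2.1) := h
      simp [twisted, h, mul_assoc]
  map_one := (hψ.map_one.preimage_fst (W := K)).preimage_snd (W := A) |>.mono
    fun i v hv h => hv <| by
      have h : ψ i 1 v.2.1 = v.2.1 := h
      simp [twisted, h]

theorem negligible_stalledWord [∀ i, Nonempty (A i)] [∀ i, Nonempty (B i)] [Group G] [Group H]
    (s : ∀ i, A i × B i → K i) (hφ : IsAlmostAction l φ)
    (hψ : IsAlmostAction l ψ)
    (hφ' : ∀ e, e ≠ 1 → Negligible l (fun i => {v | φ i e v = v}))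
    (hψ' : ∀ e, e ≠ 1 → Negligible l (fun i => {v | ψ i e v = v}))
    {r : List (G ⊕ H)} (hr : IsReducedWord r) :
    Negligible l (fun i => stalledWord (s i) (φ i) (ψ i) r) := by
  induction r with
  | nil => exact negligible_empty
  | cons x r ih =>
    refine (ih hr.of_cons).union (isNonsingular_foldr (isNonsingular_letter
      (isAlmostAction_twisted_inl s hφ) (isAlmostAction_twisted_inr s hψ)) r _ ?_)
    have hx := hr.2 x List.mem_cons_self
    cases x with
    | inl g => exact (hφ' g (by simpa using hx)).preimage_fst (W := fun i => B i × K i)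
    | inr h => exact ((hψ' h (by simpa using hx)).preimage_fst (W := K)).preimage_snd (W := A)

end Product

theorem IsAlmostAction.comp {ι κ : Type*} {l : Filter ι} {m : Filter κ} {V : ι → Type} {G : Type*}
    [Group G] {ρ : ∀ i, G → V i → V i} (h : IsAlmostAction l ρ) {p : κ → ι}
    (hp : Tendsto p m l) : IsAlmostAction m (fun k => ρ (p k)) :=
  ⟨fun e f => (h.map_mul e f).comp hp, h.map_one.comp hp⟩

end Sofic

open Sofic in
/-- The free product of two sofic groups is sofic. -/
theorem isSofic_coprod
    {G : Type*} [Group G] {H : Type*} [Group H]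
    (hG : IsSofic G) (hH : IsSofic H) :
    IsSofic (Monoid.Coprod G H) := by
  obtain ⟨A, _, _, φ, hφ, hφ'⟩ := exists_almostAction_of_isSofic hG
  obtain ⟨B, _, _, ψ, hψ, hψ'⟩ := exists_almostAction_of_isSofic hH
  let l : Filter (((ℕ × Finset G) × (ℕ × Finset H)) × ℕ) := (atTop ×ˢ atTop) ×ˢ atTop
  have hp : Tendsto (fun i => i.1.1) l atTop := tendsto_fst.comp tendsto_fst
  have hq : Tendsto (fun i => i.1.2) l atTop := tendsto_snd.comp tendsto_fst
  choose K _ _ s hs using fun i : ((ℕ × Finset G) × (ℕ × Finset H)) × ℕ =>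
    exists_finite_quotient_freeGroup (A i.1.1 × B i.1.2) i.2
  have hφl := hφ.comp hp
  have hψl := hψ.comp hq
  have hl := isAlmostAction_twisted_inl (ψ := fun i => ψ i.1.2) s hφl
  have hr := isAlmostAction_twisted_inr (φ := fun i => φ i.1.1) s hψl
  have hrep := Function.surjInv_eq (Monoid.Coprod.mk_surjective (M := G) (N := H))
  classical
  refine isSofic_of_almostAction (isAlmostAction_coprod hl hr hrep) fun w hw => ?_
  obtain ⟨r, hrw, rfl⟩ := exists_isReducedWord w
  have hne : r ≠ [] := by
    rintro rfl
    exact hw (map_one _)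
  have hstall := negligible_stalledWord s hφl hψl (fun e he => (hφ' e he).comp hp)
    (fun e he => (hψ' e he).comp hq) hrw
  have hrfix : Negligible l (fun i => {v | r.foldr
      (twisted (s i) (φ i.1.1) (ψ i.1.2)) v = v}) := by
    refine squeeze_zero' (Eventually.of_forall fun _ => by positivity) ?_ hstall
    have hlarge : ∀ᶠ i in l, 2 * r.length ≤ i.2 := tendsto_snd.eventually_ge_atTop _
    filter_upwards [hlarge] with i hi
    gcongr
    · exact Set.toFinite _
    · intro v hv
      by_contra hc
      exact foldr_twisted_ne_of_notMem_stalledWord _ _ (hs i) hrw hne hi hc hv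
  refine (hrfix.union (negligible_foldr_ne_of_mk_eq hl hr
    (w := FreeMonoid.ofList r) (hrep _))).mono fun i v hv => ?_
  by_contra hc
  simp only [Set.mem_union, Set.mem_ofPred_eq, not_or, not_not, FreeMonoid.toList_ofList] at hc hv
  exact hc.1 (hc.2.symm.trans hv)
end

section
/- Let D be a division ring, V a finite set, S a nonempty finite set, k : S → D a family of nonzero scalars, and φ : S → (V → V) a family of self-maps. Suppose X is a subset of V such that the map (s, p) ↦ φ(s)(p) is injective on S × X (i.e., whenever p, q ∈ X and s, t ∈ S with (s,p) ≠ (t,q), one has φ(s)(p) ≠ φ(t)(q)). Then the D-linear map Σ_{s∈S} k_s · T_{φ(s)} on the space of D-valued functions on V is injective on the span of { e_p : p ∈ X }; in particular its rank is at least |X|. -/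
/-- Functions in the span of the indicator functions of points of `X` vanish outside `X`. -/
theorem apply_eq_zero_of_mem_span_single {D V : Type*} [DivisionRing D] [DecidableEq V]
    {X : Set V} {x : V → D}
    (hx : x ∈ Submodule.span D ((fun p => Pi.single p (1 : D)) '' X)) {v : V} (hv : v ∉ X) :
    x v = 0 := by
  have hle : Submodule.span D ((fun p => Pi.single p (1 : D)) '' X) ≤
      LinearMap.ker (LinearMap.proj v : (V → D) →ₗ[D] D) := by
    rw [Submodule.span_le]
    rintro _ ⟨p, hp, rfl⟩
    have hvp : v ≠ p := fun h => hv (h ▸ hp)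
    simp [hvp]
  exact hle hx


/-- Let `L = Σ_{s ∈ S} k_s · T_{φ s}` be the linear endomorphism of the space of `D`-valued
functions on a finite set `V` sending each basis vector `e_v` to `Σ_{s ∈ S} e_{φ s v} · k_s`,
where the scalars `k_s` are nonzero.  If `(s, p) ↦ φ s p` is injective on `S × X`, then `L`
is injective on the span of `{e_p : p ∈ X}`; in particular its rank is at least `|X|`. -/
theorem injOn_span_and_card_le_rank
    {D : Type*} [DivisionRing D] {V S : Type*} [Fintype V] [DecidableEq V]
    [Fintype S] [Nonempty S]
    (k : S → D) (hk : ∀ s : S, k s ≠ 0) (φ : S → V → V)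
    (X : Set V)
    (hX : ∀ p ∈ X, ∀ q ∈ X, ∀ s t : S, (s, p) ≠ (t, q) → φ s p ≠ φ t q)
    (L : (V → D) →ₗ[D] (V → D))
    (hL : ∀ v : V, L (Pi.single v 1) = ∑ s : S, Pi.single (φ s v) (k s)) :
    (∀ x ∈ Submodule.span D ((fun p => Pi.single p (1 : D)) '' X), L x = 0 → x = 0) ∧
    Nat.card X ≤ Module.finrank D (LinearMap.range L) := by
  have hinj : ∀ x ∈ Submodule.span D ((fun p => Pi.single p (1 : D)) '' X), L x = 0 → x = 0 := by
    intro x hx hLx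
    funext p
    by_cases hp : p ∈ X
    swap
    · exact apply_eq_zero_of_mem_span_single hx hp
    obtain ⟨s⟩ := ‹Nonempty S›
    have hexp : L x = ∑ v, x v • ∑ t, Pi.single (φ t v) (k t) := by
      conv_lhs => rw [pi_eq_sum_univ' x]
      simp [map_sum, map_smul, hL]
    have hval : L x (φ s p) = x p * k s := by
      rw [hexp, Finset.sum_apply, Finset.sum_eq_single p]
      · rw [Pi.smul_apply, Finset.sum_apply, Finset.sum_eq_single s]
        · simp
        · intro t _ hts
          exact Pi.single_eq_of_ne (hX p hp p hp s t (by simp [hts.symm])) _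
        · simp
      · intro v _ hvp
        by_cases hv : v ∈ X
        · rw [Pi.smul_apply, Finset.sum_apply, Finset.sum_eq_zero, smul_zero]
          intro t _
          exact Pi.single_eq_of_ne (hX p hp v hv s t (by simp [hvp.symm])) _
        · simp [apply_eq_zero_of_mem_span_single hx hv]
      · simp
    rw [hLx] at hval
    exact (mul_eq_zero.mp hval.symm).resolve_right (hk s)
  refine ⟨hinj, ?_⟩
  have hli : LinearIndependent D (fun p : X => (Pi.single (p : V) (1 : D) : V → D)) := by
    simpa [Function.comp_def] using
      (Pi.basisFun D V).linearIndependent.comp ((↑) : X → V) Subtype.val_injective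
  have hLli := hli.map (f := L) (by
    rw [LinearMap.disjoint_ker]
    intro x hx
    refine hinj x ?_
    rwa [Set.image_eq_range])
  have : Fintype X := Fintype.ofFinite X
  rw [Nat.card_eq_fintype_card, ← finrank_span_eq_card hLli]
  refine Submodule.finrank_mono (Submodule.span_le.mpr ?_)
  rintro _ ⟨p, rfl⟩
  exact LinearMap.mem_range_self L _
end
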